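/- arXiv:2003.02233 — 2 statements merged into one kernel-verified Lean document; each statement's English description precedes it below -/
import Mathlib

section
/- Let d, m ≥ 1, r⃗ = (r_1,…,r_m) ∈ (0,∞)^m, q ∈ (0,∞), s ∈ (q,∞], and set ρ := (1/q − 1/s)^{-1} (ρ = q when s = ∞). There exist constants c, C > 0 depending only on d, m, q, r⃗, s such that for all measurable f_j : ℝ^d → ℂ with |f_j|^{r_j} locally integrable (1 ≤ j ≤ m) and all measurable g : ℝ^d → ℂ with |g|^ρ locally integrable: (i) for every sparse collection 𝒮 of cubes, (∑_{Q∈𝒮} (∏_{j=1}^m ⟨f_j⟩_{r_j,Q})^q ⟨g⟩_{ρ,Q}^q |Q|)^{1/q} ≤ C ‖M_{(r_1,…,r_m,ρ)}(f_1,…,f_m,g)‖_{L^q(ℝ^d)}; and (ii) there exists a sparse collection 𝒮 of cubes with ‖M_{(r_1,…,r_m,ρ)}(f_1,…,f_m,g)‖_{L^q(ℝ^d)} ≤ C (∑_{Q∈𝒮} (∏_{j=1}^m ⟨f_j⟩_{r_j,Q})^q ⟨g⟩_{ρ,Q}^q |Q|)^{1/q}. -/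
open MeasureTheory ENNReal

noncomputable section

structure Cube (d : ℕ) where
  corner : Fin d → ℝ
  side : ℝ
  side_pos : 0 < side

namespace Cube
def set {d : ℕ} (Q : Cube d) : Set (Fin d → ℝ) :=
  {x | ∀ i, Q.corner i ≤ x i ∧ x i < Q.corner i + Q.side}
def vol {d : ℕ} (Q : Cube d) : ℝ≥0∞ := volume Q.set
def IsDyadic {d : ℕ} (Q : Cube d) : Prop :=
  ∃ (k : ℤ) (n : Fin d → ℤ), Q.side = (2:ℝ) ^ (-k) ∧ ∀ i, Q.corner i = (2:ℝ) ^ (-k) * (n i : ℝ)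
end Cube

def IsSparse {d : ℕ} (S : Set (Cube d)) : Prop :=
  ∃ E : Cube d → Set (Fin d → ℝ),
    (∀ Q ∈ S, MeasurableSet (E Q) ∧ E Q ⊆ Q.set ∧ Q.vol ≤ 2 * volume (E Q)) ∧
    S.PairwiseDisjoint E

def eNorm {α : Type*} [MeasurableSpace α] (p : ℝ≥0∞) (μ : Measure α) (F : α → ℝ≥0∞) : ℝ≥0∞ :=
  if p = ∞ then essSup F μ else (∫⁻ x, F x ^ p.toReal ∂μ) ^ (1 / p.toReal)

def nn {α : Type*} (f : α → ℂ) : α → ℝ≥0∞ := fun x => (‖f x‖₊ : ℝ≥0∞)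

def avg {d : ℕ} (r : ℝ≥0∞) (F : (Fin d → ℝ) → ℝ≥0∞) (Q : Cube d) : ℝ≥0∞ :=
  if r = ∞ then essSup F (volume.restrict Q.set)
  else ((∫⁻ x in Q.set, F x ^ r.toReal) / Q.vol) ^ (1 / r.toReal)

def maximal {d k : ℕ} (r : Fin k → ℝ≥0∞) (F : Fin k → (Fin d → ℝ) → ℝ≥0∞)
    (x : Fin d → ℝ) : ℝ≥0∞ :=
  ⨆ (Q : Cube d) (_ : x ∈ Q.set), ∏ j, avg (r j) (F j) Q

def maximalX {d k : ℕ} (r : Fin k → ℝ≥0∞) (ρ : ℝ≥0∞) (F : Fin k → (Fin d → ℝ) → ℝ≥0∞)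
    (G : (Fin d → ℝ) → ℝ≥0∞) (x : Fin d → ℝ) : ℝ≥0∞ :=
  ⨆ (Q : Cube d) (_ : x ∈ Q.set), (∏ j, avg (r j) (F j) Q) * avg ρ G Q

def wNorm {d : ℕ} (p : ℝ≥0∞) (w : (Fin d → ℝ) → ℝ) (F : (Fin d → ℝ) → ℝ≥0∞) : ℝ≥0∞ :=
  eNorm p volume (fun x => F x * ENNReal.ofReal (w x))

def aConst {d m : ℕ} (p r : Fin m → ℝ≥0∞) (s : ℝ≥0∞)
    (w : Fin m → (Fin d → ℝ) → ℝ) : ℝ≥0∞ :=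
  ⨆ Q : Cube d,
    (∏ j, avg ((r j)⁻¹ - (p j)⁻¹)⁻¹ (fun x => ENNReal.ofReal (w j x)⁻¹) Q) *
      avg ((∑ j, (p j)⁻¹) - s⁻¹)⁻¹ (fun x => ENNReal.ofReal (∏ j, w j x)) Q

def latAvg {d : ℕ} {Ω : Type*} (r : ℝ≥0∞) (f : (Fin d → ℝ) → Ω → ℂ) (Q : Cube d) (ω : Ω) : ℝ≥0∞ :=
  ((∫⁻ y in Q.set, (‖f y ω‖₊ : ℝ≥0∞) ^ r.toReal) / Q.vol) ^ (1 / r.toReal)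

def latMax {d m : ℕ} {Ω : Type*} (r : Fin m → ℝ≥0∞) (D : Finset (Cube d))
    (f : Fin m → (Fin d → ℝ) → Ω → ℂ) (x : Fin d → ℝ) (ω : Ω) : ℝ≥0∞ :=
  ⨆ Q ∈ D, ⨆ (_ : x ∈ Cube.set Q), ∏ j, latAvg (r j) (f j) Q ω

def latMaxX {d m : ℕ} {Ω : Type*} (r : Fin m → ℝ≥0∞) (ρ : ℝ≥0∞) (D : Finset (Cube d))
    (f : Fin m → (Fin d → ℝ) → Ω → ℂ) (g : (Fin d → ℝ) → Ω → ℂ)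
    (x : Fin d → ℝ) (ω : Ω) : ℝ≥0∞ :=
  ⨆ Q ∈ D, ⨆ (_ : x ∈ Cube.set Q), (∏ j, latAvg (r j) (f j) Q ω) * latAvg ρ g Q ω

def MemLinftyC {d : ℕ} (f : (Fin d → ℝ) → ℂ) : Prop :=
  Measurable f ∧ (∃ M : ℝ, ∀ x, ‖f x‖ ≤ M) ∧ Bornology.IsBounded (Function.support f)

def SimpleLinftyC {d : ℕ} (f : (Fin d → ℝ) → ℂ) : Prop :=
  Measurable f ∧ (Set.range f).Finite ∧ Bornology.IsBounded (Function.support f)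

def PairSimple {d : ℕ} {Ω : Type*} [MeasurableSpace Ω] (f : (Fin d → ℝ) → Ω → ℂ) : Prop :=
  Measurable (Function.uncurry f) ∧ (Set.range (Function.uncurry f)).Finite ∧
    ∃ B : Set (Fin d → ℝ), Bornology.IsBounded B ∧ ∀ x ∉ B, ∀ ω, f x ω = 0

def VecSimple {d : ℕ} {Ω : Type*} [MeasurableSpace Ω] (f : (Fin d → ℝ) → Ω → ℂ) : Prop :=
  ∃ (N : ℕ) (A : Fin N → Set (Fin d → ℝ)) (ξ : Fin N → Ω → ℂ),
    (∀ i, MeasurableSet (A i)) ∧ (∀ i, Bornology.IsBounded (A i)) ∧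
    (∀ i, Measurable (ξ i)) ∧ (∃ M : ℝ, ∀ i ω, ‖ξ i ω‖ ≤ M) ∧
    ∀ x ω, f x ω = ∑ i, (A i).indicator (fun _ => ξ i ω) x

section
variable {d : ℕ}

lemma Cube.set_eq (Q : Cube d) :
    Q.set = Set.univ.pi (fun i => Set.Ico (Q.corner i) (Q.corner i + Q.side)) := by
  ext x; simp [Cube.set]

lemma Cube.meas (Q : Cube d) : MeasurableSet Q.set := by
  rw [Q.set_eq]; exact MeasurableSet.univ_pi (fun i => measurableSet_Ico)

lemma Cube.vol_eq (Q : Cube d) : Q.vol = ENNReal.ofReal Q.side ^ d := by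
  simp [Cube.vol, Q.set_eq, volume_pi_pi]

lemma Cube.vol_ne_zero (Q : Cube d) : Q.vol ≠ 0 := by
  rw [Q.vol_eq]; exact pow_ne_zero _ (by simpa using Q.side_pos)

lemma Cube.vol_ne_top (Q : Cube d) : Q.vol ≠ ∞ := by
  rw [Q.vol_eq]; exact ENNReal.pow_ne_top ENNReal.ofReal_ne_top

def gAv (H : (Fin d → ℝ) → ℝ≥0∞) (Q : Cube d) : ℝ≥0∞ := (∫⁻ x in Q.set, H x) / Q.vol

def gA {ι : Type*} [Fintype ι] (p : ι → ℝ) (H : ι → (Fin d → ℝ) → ℝ≥0∞) (Q : Cube d) : ℝ≥0∞ :=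
  ∏ j, (gAv (H j) Q) ^ (1 / p j)

def kap {ι : Type*} [Fintype ι] (p : ι → ℝ) (c : ℝ≥0∞) : ℝ≥0∞ := ∏ j, c ^ (1 / p j)

lemma kap_ne_top {ι : Type*} [Fintype ι] (p : ι → ℝ) (hp : ∀ j, 0 < p j) (c : ℝ≥0∞) (hc : c ≠ ∞) :
    kap p c ≠ ∞ :=
  ENNReal.prod_ne_top fun j _ => ENNReal.rpow_ne_top_of_nonneg (one_div_pos.2 (hp j)).le hc

lemma one_le_kap {ι : Type*} [Fintype ι] (p : ι → ℝ) (hp : ∀ j, 0 < p j) (c : ℝ≥0∞) (hc : 1 ≤ c) :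
    1 ≤ kap p c :=
  Finset.one_le_prod' fun j _ => ENNReal.one_le_rpow hc (one_div_pos.2 (hp j))

lemma gAv_mono (H : (Fin d → ℝ) → ℝ≥0∞) {Q Q' : Cube d} {c : ℝ≥0∞} (h : Q.set ⊆ Q'.set)
    (hc : Q'.vol ≤ c * Q.vol) : gAv H Q ≤ c * gAv H Q' := by
  have h1 : (Q.vol)⁻¹ ≤ c * (Q'.vol)⁻¹ := by
    rw [← div_eq_mul_inv, ENNReal.le_div_iff_mul_le (Or.inl Q'.vol_ne_zero) (Or.inl Q'.vol_ne_top),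
      mul_comm, ← div_eq_mul_inv]
    exact ENNReal.div_le_of_le_mul hc
  unfold gAv
  rw [div_eq_mul_inv, div_eq_mul_inv]
  calc _ ≤ (∫⁻ x in Q'.set, H x) * (c * (Q'.vol)⁻¹) :=
        mul_le_mul' (lintegral_mono_set h) h1
    _ = _ := by ring

lemma gA_mono {ι : Type*} [Fintype ι] (p : ι → ℝ) (hp : ∀ j, 0 < p j)
    (H : ι → (Fin d → ℝ) → ℝ≥0∞) {Q Q' : Cube d} {c : ℝ≥0∞} (h : Q.set ⊆ Q'.set)
    (hc : Q'.vol ≤ c * Q.vol) : gA p H Q ≤ kap p c * gA p H Q' := by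
  unfold gA kap
  rw [← Finset.prod_mul_distrib]
  refine Finset.prod_le_prod' fun j _ => ?_
  rw [← ENNReal.mul_rpow_of_nonneg _ _ (one_div_pos.2 (hp j)).le]
  exact ENNReal.rpow_le_rpow (gAv_mono _ h hc) (one_div_pos.2 (hp j)).le

lemma gA_ne_top {ι : Type*} [Fintype ι] (p : ι → ℝ) (hp : ∀ j, 0 < p j)
    (H : ι → (Fin d → ℝ) → ℝ≥0∞) (Q : Cube d) (hH : ∀ j, ∫⁻ x in Q.set, H j x < ∞) :
    gA p H Q ≠ ∞ :=
  ENNReal.prod_ne_top fun j _ => ENNReal.rpow_ne_top_of_nonneg (one_div_pos.2 (hp j)).le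
    (ENNReal.div_ne_top (hH j).ne Q.vol_ne_zero)

/-- If the product jumps, one of the factors jumps. -/
lemma exists_factor {ι : Type*} [Fintype ι] (p : ι → ℝ) (hp : ∀ j, 0 < p j)
    (H : ι → (Fin d → ℝ) → ℝ≥0∞) {Q Q' : Cube d} {c : ℝ≥0∞}
    (h : kap p c * gA p H Q < gA p H Q') : ∃ j, c * gAv (H j) Q < gAv (H j) Q' := by
  by_contra! hcon
  refine absurd h (not_lt.2 ?_)
  unfold gA kap
  rw [← Finset.prod_mul_distrib]
  refine Finset.prod_le_prod' fun j _ => ?_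
  rw [← ENNReal.mul_rpow_of_nonneg _ _ (one_div_pos.2 (hp j)).le]
  exact ENNReal.rpow_le_rpow (hcon j) (one_div_pos.2 (hp j)).le

structure IsGrid (D : ℤ → (Fin d → ℝ) → Cube d) : Prop where
  mem : ∀ k x, x ∈ (D k x).set
  eq : ∀ k x y, y ∈ (D k x).set → D k y = D k x
  sub : ∀ k x, (D (k + 1) x).set ⊆ (D k x).set
  side : ∀ k x, (D k x).side = (2 : ℝ) ^ (-k)
  cnt : (Set.range (Function.uncurry D)).Countable

namespace IsGrid
variable {D : ℤ → (Fin d → ℝ) → Cube d}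

lemma anti (hD : IsGrid D) (x : Fin d → ℝ) {k l : ℤ} (h : k ≤ l) :
    (D l x).set ⊆ (D k x).set := by
  induction l, h using Int.leInduction with
  | base => exact subset_rfl
  | succ n hn ih => exact (hD.sub n x).trans ih

lemma vol_parent (hD : IsGrid D) (x : Fin d → ℝ) (k : ℤ) :
    (D (k - 1) x).vol ≤ 2 ^ d * (D k x).vol := by
  rw [Cube.vol_eq, Cube.vol_eq, hD.side, hD.side, ← mul_pow]
  refine pow_le_pow_left' ?_ d
  have : (2 : ℝ) ^ (-(k - 1)) = 2 * 2 ^ (-k) := by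
    rw [neg_sub, sub_eq_add_neg, zpow_add₀ two_ne_zero, zpow_one]
  rw [this, ENNReal.ofReal_mul (by norm_num)]
  simp

/-- Local dyadic weak type (1,1) estimate. -/
lemma weak (hD : IsGrid D) (k0 : ℤ) (x0 : Fin d → ℝ) (H : (Fin d → ℝ) → ℝ≥0∞)
    (lam : ℝ≥0∞) :
    lam * volume {x | x ∈ (D k0 x0).set ∧ ∃ k, k0 ≤ k ∧ lam < gAv H (D k x)} ≤
      ∫⁻ x in (D k0 x0).set, H x := by
  set U := {x | x ∈ (D k0 x0).set ∧ ∃ k, k0 ≤ k ∧ lam < gAv H (D k x)} with hU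
  have hex : ∀ x, x ∈ U → ∃ k, (k0 ≤ k ∧ lam < gAv H (D k x)) ∧
      ∀ z, (k0 ≤ z ∧ lam < gAv H (D z x)) → k ≤ z := fun x hx =>
    Int.exists_least_of_bdd ⟨k0, fun z hz => hz.1⟩ hx.2
  let T : Set (Cube d) := {Q | ∃ x ∈ U, ∃ k, Q = D k x ∧ (k0 ≤ k ∧ lam < gAv H (D k x)) ∧
      ∀ z, (k0 ≤ z ∧ lam < gAv H (D z x)) → k ≤ z}
  have hTc : T.Countable := hD.cnt.mono (by
    rintro Q ⟨x, -, k, rfl, -⟩; exact ⟨(k, x), rfl⟩)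
  have hcov : U ⊆ ⋃ Q ∈ T, Q.set := by
    intro x hx
    obtain ⟨k, hk⟩ := hex x hx
    exact Set.mem_biUnion (⟨x, hx, k, rfl, hk⟩ : D k x ∈ T) (hD.mem k x)
  have hTsub : (⋃ Q ∈ T, Q.set) ⊆ (D k0 x0).set := by
    refine Set.iUnion₂_subset ?_
    rintro Q ⟨x, hx, k, rfl, hk, -⟩
    refine (hD.anti x hk.1).trans ?_
    rw [hD.eq k0 x0 x hx.1]
  have hdisj : T.PairwiseDisjoint Cube.set := by
    rintro Q ⟨x, hx, k, rfl, hk, hk'⟩ Q' ⟨y, hy, l, rfl, hl, hl'⟩ hne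
    refine Set.disjoint_left.2 fun z hz hz' => hne ?_
    have e1 := hD.eq _ _ _ hz
    have e2 := hD.eq _ _ _ hz'
    have key : ∀ (x y : Fin d → ℝ) (k l : ℤ), z ∈ (D k x).set → z ∈ (D l y).set →
        (k0 ≤ k ∧ lam < gAv H (D k x)) → l ≤ k → (∀ w, (k0 ≤ w ∧ lam < gAv H (D w y)) → l ≤ w) →
        (k0 ≤ l ∧ lam < gAv H (D l y)) →
        (∀ w, (k0 ≤ w ∧ lam < gAv H (D w x)) → k ≤ w) → k ≤ l := by
      intro x y k l hx hy _ hlk _ hl hk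
      refine hk l ⟨hl.1, ?_⟩
      have : D l x = D l y := by
        rw [← hD.eq l x z (hD.anti x hlk hx), hD.eq l y z hy]
      rw [this]; exact hl.2
    have hkl : k = l := by
      rcases le_total k l with h | h
      · exact le_antisymm h (key y x l k hz' hz hl h hk' hk hl')
      · exact le_antisymm (key x y k l hz hz' hk h hl' hl hk') h
    subst hkl
    rw [← e1, ← e2]
  have := hTc.to_subtype
  calc lam * volume U ≤ lam * ∑' Q : T, volume (Q : Cube d).set := by
        gcongr
        exact (measure_mono hcov).trans (measure_biUnion_le _ hTc _)
    _ = ∑' Q : T, lam * (Q : Cube d).vol := by rw [ENNReal.tsum_mul_left]; rfl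
    _ ≤ ∑' Q : T, ∫⁻ x in (Q : Cube d).set, H x := by
        refine ENNReal.tsum_le_tsum ?_
        rintro ⟨Q, x, hx, k, rfl, hk, -⟩
        have := hk.2.le
        unfold gAv at this
        exact (ENNReal.le_div_iff_mul_le (Or.inl (Cube.vol_ne_zero _))
          (Or.inl (Cube.vol_ne_top _))).1 this
    _ = ∫⁻ x in ⋃ Q ∈ T, Q.set, H x := by
        rw [lintegral_biUnion hTc (fun Q _ => Q.meas) hdisj]
    _ ≤ _ := lintegral_mono_set hTsub

end IsGrid
end
section
variable {d : ℕ}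

lemma IsGrid.exists_sparse (hd : 1 ≤ d) {D : ℤ → (Fin d → ℝ) → Cube d} (hD : IsGrid D)
    {ι : Type*} [Fintype ι] [Nonempty ι] (p : ι → ℝ) (hp : ∀ j, 0 < p j)
    (H : ι → (Fin d → ℝ) → ℝ≥0∞) (hH : ∀ j (Q : Cube d), ∫⁻ x in Q.set, H j x < ∞)
    (hb : ∀ lam : ℝ≥0∞, 0 < lam → ∃ B : ℝ, ∀ Q : Cube d, lam < gA p H Q → Q.side ≤ B)
    (a : ℝ≥0∞) (ha : kap p (2 * (Fintype.card ι : ℝ≥0∞)) * kap p (2 ^ d) ≤ a) (ha1 : 1 < a)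
    (hat : a ≠ ∞) :
    ∃ S : Set (Cube d), S.Countable ∧ IsSparse S ∧
      ∀ k x, gA p H (D k x) ≠ 0 → ∃ Q ∈ S, x ∈ Q.set ∧ gA p H (D k x) ≤ a * gA p H Q := by
  have ha0 : a ≠ 0 := (zero_lt_one.trans ha1).ne'
  let S : Set (Cube d) := {Q | ∃ (l : ℤ) (x : Fin d → ℝ) (k : ℤ), Q = D k x ∧ a ^ l < gA p H (D k x) ∧
    ∀ k', a ^ l < gA p H (D k' x) → k ≤ k'}
  have hSc : S.Countable := hD.cnt.mono (by
    rintro Q ⟨l, x, k, rfl, -⟩; exact ⟨(k, x), rfl⟩)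
  have hT : ∀ Q : Cube d, {Q' ∈ S | Q'.set ⊂ Q.set}.Countable := fun Q =>
    hSc.mono fun _ h => h.1
  let V : Cube d → Set (Fin d → ℝ) := fun Q => ⋃ Q' ∈ {Q' ∈ S | Q'.set ⊂ Q.set}, Q'.set
  refine ⟨S, hSc, ⟨fun Q => Q.set \ V Q, ?_, ?_⟩, ?_⟩
  · rintro Q hQ
    have hVm : MeasurableSet (V Q) := MeasurableSet.biUnion (hT Q) fun Q' _ => Q'.meas
    refine ⟨Q.meas.diff hVm, Set.sdiff_subset, ?_⟩
    obtain ⟨l, x, k, rfl, hl, hmin⟩ := hQ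
    set Q := D k x with hQdef
    set N : ℝ≥0∞ := (Fintype.card ι : ℝ≥0∞) with hN
    have hN0 : N ≠ 0 := by simp [hN]
    have hNt : N ≠ ∞ := by simp [hN]
    let U : ι → Set (Fin d → ℝ) := fun j =>
      {y | y ∈ (D k x).set ∧ ∃ k', k ≤ k' ∧ (2 * N * gAv (H j) Q) < gAv (H j) (D k' y)}
    have hVU : V Q ⊆ ⋃ j, U j := by
      refine Set.iUnion₂_subset ?_
      rintro Q' ⟨⟨l', x', k', rfl, hl', hmin'⟩, hss⟩ y hy
      have hyQ : y ∈ Q.set := hss.1 hy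
      have e1 : D k' y = D k' x' := hD.eq _ _ _ hy
      have e2 : D k y = Q := hD.eq _ _ _ hyQ
      have e3 : D k x' = Q := hD.eq _ _ _ (hss.1 (hD.mem k' x'))
      have hkk : k < k' := by
        by_contra! hcon
        refine hss.2 ?_
        rw [← e1, ← e2]
        exact hD.anti y hcon
      have h1 : gA p H Q ≤ a ^ l' := by
        by_contra! hcon
        rw [← e3] at hcon
        exact absurd (hmin' k hcon) (not_le.2 hkk)
      have hll : l < l' := by
        by_contra! hcon
        exact absurd (hl.trans_le h1) (not_lt.2 (ENNReal.zpow_le_of_le ha1.le hcon))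
      have h2 : gA p H Q ≤ kap p (2 ^ d) * a ^ l := by
        refine (gA_mono p hp H (Q' := D (k - 1) x) (hD.anti x (by lia)) (hD.vol_parent x k)).trans ?_
        gcongr
        by_contra! hcon
        have := hmin _ hcon
        lia
      have h3 : kap p (2 * N) * gA p H Q < gA p H (D k' x') := by
        calc kap p (2 * N) * gA p H Q ≤ kap p (2 * N) * (kap p (2 ^ d) * a ^ l) := by gcongr
          _ = (kap p (2 * N) * kap p (2 ^ d)) * a ^ l := by ring
          _ ≤ a * a ^ l := by gcongr
          _ = a ^ (l + 1) := by rw [ENNReal.zpow_add ha0 hat, zpow_one, mul_comm]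
          _ ≤ a ^ l' := ENNReal.zpow_le_of_le ha1.le (by lia)
          _ < _ := hl'
      obtain ⟨j, hj⟩ := exists_factor p hp H h3
      refine Set.mem_iUnion.2 ⟨j, hyQ, k', hkk.le, ?_⟩
      rw [e1]; exact hj
    have hUj : ∀ j, 2 * N * volume (U j) ≤ Q.vol := by
      intro j
      have h := hD.weak k x (H j) (2 * N * gAv (H j) Q)
      have hne : gAv (H j) Q ≠ 0 := by
        intro h0
        refine absurd hl (not_lt.2 ?_)
        have : gA p H (D k x) = 0 := by
          refine Finset.prod_eq_zero (Finset.mem_univ j) ?_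
          rw [← hQdef, h0, ENNReal.zero_rpow_of_pos (one_div_pos.2 (hp j))]
        rw [this]; exact zero_le
      have hnt : gAv (H j) Q ≠ ∞ := ENNReal.div_ne_top (hH j Q).ne Q.vol_ne_zero
      have e : ∫⁻ x in Q.set, H j x = gAv (H j) Q * Q.vol :=
        (ENNReal.div_mul_cancel Q.vol_ne_zero Q.vol_ne_top).symm
      rw [← hQdef, e] at h
      rw [← ENNReal.mul_le_mul_iff_right hne hnt]
      refine le_trans (le_of_eq ?_) h
      show gAv (H j) Q * (2 * N * volume (U j)) = 2 * N * gAv (H j) Q * volume (U j)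
      ring
    have hV2 : 2 * volume (V Q) ≤ Q.vol := by
      rw [← ENNReal.mul_le_mul_iff_right hN0 hNt]
      calc N * (2 * volume (V Q)) ≤ N * (2 * ∑ j, volume (U j)) := by
            gcongr
            exact (measure_mono hVU).trans (measure_iUnion_fintype_le _ _)
        _ = ∑ j, 2 * N * volume (U j) := by rw [← Finset.mul_sum]; ring
        _ ≤ ∑ _j : ι, Q.vol := Finset.sum_le_sum fun j _ => hUj j
        _ = N * Q.vol := by simp [hN]
    have h4 : Q.vol ≤ volume (Q.set \ V Q) + volume (V Q) := by
      refine (measure_mono ?_).trans (measure_union_le _ _)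
      intro z hz
      by_cases h : z ∈ V Q
      · exact Or.inr h
      · exact Or.inl ⟨hz, h⟩
    have h5 : Q.vol + Q.vol ≤ 2 * volume (Q.set \ V Q) + Q.vol := by
      calc Q.vol + Q.vol = 2 * Q.vol := (two_mul _).symm
        _ ≤ 2 * (volume (Q.set \ V Q) + volume (V Q)) := by gcongr
        _ = 2 * volume (Q.set \ V Q) + 2 * volume (V Q) := by ring
        _ ≤ _ := by gcongr
    exact (ENNReal.add_le_add_iff_right Q.vol_ne_top).1 h5
  · rintro Q hQ Q' hQ' hne
    refine Set.disjoint_left.2 fun z hz hz' => ?_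
    have key : ∀ Q ∈ S, ∀ Q' ∈ S, Q ≠ Q' → z ∈ Q.set → z ∈ Q'.set → Q.set ⊆ Q'.set → z ∈ V Q' := by
      intro Q hQ Q' hQ' hne hz hz' hsub
      refine Set.mem_biUnion (⟨hQ, hsub, fun hsup => hne ?_⟩ : Q ∈ {Q ∈ S | Q.set ⊂ Q'.set}) hz
      obtain ⟨l, x, k, rfl, -, hmin⟩ := hQ
      obtain ⟨l', x', k', rfl, -, hmin'⟩ := hQ'
      have hs : (D k x).set = (D k' x').set := Set.Subset.antisymm hsub hsup
      by_cases hkk : k = k'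
      · subst hkk
        rw [← hD.eq _ _ _ hz, ← hD.eq _ _ _ hz']
      · exfalso
        have hv : (D k x).vol = (D k' x').vol := by unfold Cube.vol; rw [hs]
        rw [Cube.vol_eq, Cube.vol_eq, hD.side, hD.side] at hv
        have h6 := (ENNReal.pow_right_strictMono (by lia : d ≠ 0)).injective hv
        rw [ENNReal.ofReal_eq_ofReal_iff (by positivity) (by positivity)] at h6
        have h7 := zpow_right_injective₀ (by norm_num : (0 : ℝ) < 2) (by norm_num) h6
        lia
    obtain ⟨l, x, k, rfl, -⟩ := id hQ
    obtain ⟨l', x', k', rfl, -⟩ := id hQ'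
    rcases le_total k k' with h | h
    · refine hz.2 (key _ hQ' _ hQ hne.symm hz'.1 hz.1 ?_)
      rw [← hD.eq _ _ _ hz.1, ← hD.eq _ _ _ hz'.1]
      exact hD.anti z h
    · refine hz'.2 (key _ hQ _ hQ' hne hz.1 hz'.1 ?_)
      rw [← hD.eq _ _ _ hz.1, ← hD.eq _ _ _ hz'.1]
      exact hD.anti z h
  · intro k x h0
    obtain ⟨l, hl1, hl2⟩ := ENNReal.exists_mem_Ioc_zpow h0 (gA_ne_top p hp H _ fun j => hH j _) ha1 hat
    obtain ⟨B, hB⟩ := hb (a ^ l) (ENNReal.zpow_pos ha0 hat l)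
    obtain ⟨n, hn⟩ := pow_unbounded_of_one_lt B (one_lt_two : (1 : ℝ) < 2)
    obtain ⟨k', hk', hmin⟩ := Int.exists_least_of_bdd (P := fun z => a ^ l < gA p H (D z x))
      ⟨-(n : ℤ), fun z hz => by
        have h1 := (hB _ hz).trans_lt hn
        rw [hD.side, ← zpow_natCast, zpow_lt_zpow_iff_right₀ (by norm_num)] at h1
        lia⟩ ⟨k, hl1⟩
    refine ⟨D k' x, ⟨l, x, k', rfl, hk', hmin⟩, hD.mem _ _, hl2.trans ?_⟩
    rw [ENNReal.zpow_add ha0 hat, zpow_one, mul_comm]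
    gcongr
end
section
variable {d : ℕ}

lemma case_one (hd : 1 ≤ d) (A : Cube d → ℝ≥0∞) (lam : ℝ≥0∞) (hlam : 0 < lam)
    (h : ∀ B : ℝ, ∃ Q : Cube d, lam < A Q ∧ B < Q.side) (q : ℝ) (hq : 0 < q) :
    ∃ S : Set (Cube d), IsSparse S ∧ ∑' Q : S, A (Q : Cube d) ^ q * (Q : Cube d).vol = ∞ := by
  choose nxt hn1 hn2 using h
  let P : ℕ → Cube d := fun n => Nat.rec (nxt 1) (fun _ Q => nxt (max 1 (4 * Q.side))) n
  have hP0 : P 0 = nxt 1 := rfl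
  have hPs : ∀ n, P (n + 1) = nxt (max 1 (4 * (P n).side)) := fun n => rfl
  have hA : ∀ n, lam < A (P n) := by
    intro n; cases n with
    | zero => rw [hP0]; exact hn1 _
    | succ n => rw [hPs]; exact hn1 _
  have h1 : ∀ n, 1 < (P n).side := by
    intro n; cases n with
    | zero => rw [hP0]; exact hn2 _
    | succ n => rw [hPs]; exact (le_max_left _ _).trans_lt (hn2 _)
  have h4 : ∀ n, 4 * (P n).side < (P (n + 1)).side := by
    intro n; rw [hPs]; exact (le_max_right _ _).trans_lt (hn2 _)
  have hmono : StrictMono fun n => (P n).side :=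
    strictMono_nat_of_lt_succ fun n => by
      have := h1 n; have := h4 n; linarith
  have hinj : Function.Injective P := fun a b hab => hmono.injective (by simp [hab])
  have hv1 : ∀ n, 1 ≤ (P n).vol := by
    intro n; rw [Cube.vol_eq]
    exact one_le_pow₀ (by simpa using (h1 n).le)
  have hv4 : ∀ n, 4 * (P n).vol ≤ (P (n + 1)).vol := by
    intro n
    rw [Cube.vol_eq, Cube.vol_eq]
    calc 4 * ENNReal.ofReal (P n).side ^ d ≤ 4 ^ d * ENNReal.ofReal (P n).side ^ d := by
          gcongr
          exact le_self_pow₀ (by norm_num) (by lia)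
      _ = (ENNReal.ofReal (4 * (P n).side)) ^ d := by
          rw [ENNReal.ofReal_mul (by norm_num), mul_pow]; simp
      _ ≤ _ := by gcongr; exact (h4 n).le
  have hsum : ∀ n, 2 * ∑ i ∈ Finset.range n, (P i).vol ≤ (P n).vol := by
    intro n
    induction n with
    | zero => simp
    | succ n ih =>
      rw [Finset.sum_range_succ, mul_add]
      calc _ ≤ (P n).vol + 2 * (P n).vol := by gcongr
        _ ≤ 4 * (P n).vol := by
          rw [← one_add_mul]; gcongr; norm_num
        _ ≤ _ := hv4 n
  let V : Cube d → Set (Fin d → ℝ) := fun Q => ⋃ i ∈ {i | (P i).side < Q.side}, (P i).set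
  refine ⟨Set.range P, ⟨fun Q => Q.set \ V Q, ?_, ?_⟩, ?_⟩
  · rintro _ ⟨n, rfl⟩
    refine ⟨(P n).meas.diff (MeasurableSet.biUnion (Set.to_countable _) fun i _ => (P i).meas),
      Set.sdiff_subset, ?_⟩
    have hset : V (P n) = ⋃ i ∈ Finset.range n, (P i).set := by
      show (⋃ i ∈ {i | (P i).side < (P n).side}, (P i).set) = _
      ext z
      simp only [Set.mem_iUnion, Set.mem_ofPred_eq, Finset.mem_range, exists_prop]
      exact exists_congr fun i => and_congr_left fun _ => hmono.lt_iff_lt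
    have hV2 : 2 * volume (V (P n)) ≤ (P n).vol := by
      refine le_trans ?_ (hsum n)
      gcongr
      rw [hset]
      exact measure_biUnion_finset_le _ _
    have h4 : (P n).vol ≤ volume ((P n).set \ V (P n)) + volume (V (P n)) := by
      refine (measure_mono ?_).trans (measure_union_le _ _)
      intro z hz
      by_cases h : z ∈ V (P n)
      · exact Or.inr h
      · exact Or.inl ⟨hz, h⟩
    have h5 : (P n).vol + (P n).vol ≤ 2 * volume ((P n).set \ V (P n)) + (P n).vol := by
      calc (P n).vol + (P n).vol = 2 * (P n).vol := (two_mul _).symm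
        _ ≤ 2 * (volume ((P n).set \ V (P n)) + volume (V (P n))) := by gcongr
        _ = 2 * volume ((P n).set \ V (P n)) + 2 * volume (V (P n)) := by ring
        _ ≤ _ := by gcongr
    exact (ENNReal.add_le_add_iff_right (P n).vol_ne_top).1 h5
  · rintro _ ⟨n, rfl⟩ _ ⟨k, rfl⟩ hne
    refine Set.disjoint_left.2 fun z hz hz' => ?_
    rcases lt_trichotomy n k with h | h | h
    · exact hz'.2 (Set.mem_biUnion (show n ∈ {i | (P i).side < (P k).side} from hmono h) hz.1)
    · exact hne (by rw [h])
    · exact hz.2 (Set.mem_biUnion (show k ∈ {i | (P i).side < (P n).side} from hmono h) hz'.1)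
  · rw [tsum_range (fun Q : Cube d => A Q ^ q * Q.vol) hinj]
    have hc : lam ^ q ≠ 0 := by
      simp [ENNReal.rpow_eq_zero_iff, hlam.ne', hq.le]
    rw [eq_top_iff, ← ENNReal.tsum_const_eq_top_of_ne_zero (α := ℕ) hc]
    refine ENNReal.tsum_le_tsum fun n => ?_
    calc lam ^ q = lam ^ q * 1 := (mul_one _).symm
      _ ≤ _ := mul_le_mul' (ENNReal.rpow_le_rpow (hA n).le hq.le) (hv1 n)

/-- shifted dyadic grids -/
def gridN (α : Fin d → Fin 2) (k : ℤ) (x : Fin d → ℝ) (i : Fin d) : ℤ :=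
  ⌊(2 : ℝ) ^ k * x i - (-1 : ℝ) ^ k * ((α i : ℕ) : ℝ) / 3⌋

def gridC (α : Fin d → Fin 2) (k : ℤ) (n : Fin d → ℤ) : Cube d where
  corner := fun i => (2 : ℝ) ^ (-k) * (n i + (-1 : ℝ) ^ k * ((α i : ℕ) : ℝ) / 3)
  side := (2 : ℝ) ^ (-k)
  side_pos := by positivity

def gridD (α : Fin d → Fin 2) (k : ℤ) (x : Fin d → ℝ) : Cube d := gridC α k (gridN α k x)

lemma mem_gridC (α : Fin d → Fin 2) (k : ℤ) (n : Fin d → ℤ) (y : Fin d → ℝ) :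
    y ∈ (gridC α k n).set ↔ gridN α k y = n := by
  rw [funext_iff]
  refine forall_congr' fun i => ?_
  simp only [gridC, gridN, Int.floor_eq_iff]
  have hpos : (0 : ℝ) < 2 ^ k := by positivity
  rw [zpow_neg]
  set t := (-1 : ℝ) ^ k * ((α i : ℕ) : ℝ) / 3
  set w := (2 : ℝ) ^ k
  have e : w⁻¹ * (n i + t) + w⁻¹ = w⁻¹ * (n i + t + 1) := by ring
  rw [e, inv_mul_le_iff₀ hpos, lt_inv_mul_iff₀ hpos]
  constructor <;> rintro ⟨h1, h2⟩ <;> constructor <;> linarith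

lemma gridN_succ (α : Fin d → Fin 2) (k : ℤ) (x y : Fin d → ℝ)
    (h : gridN α (k + 1) y = gridN α (k + 1) x) : gridN α k y = gridN α k x := by
  funext i
  have hi := congrFun h i
  obtain ⟨e, he⟩ : ∃ e : ℤ, (-1 : ℝ) ^ k * ((α i : ℕ) : ℝ) = e := by
    rcases Int.even_or_odd k with hk | hk
    · exact ⟨((α i : ℕ) : ℤ), by rw [hk.neg_one_zpow]; simp⟩
    · exact ⟨-((α i : ℕ) : ℤ), by rw [hk.neg_one_zpow]; simp⟩
  have key : ∀ z : Fin d → ℝ, gridN α k z i = (gridN α (k + 1) z i - e) / 2 := by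
    intro z
    have h1 : (2 : ℝ) ^ (k + 1) * z i - (-1 : ℝ) ^ (k + 1) * ((α i : ℕ) : ℝ) / 3
        = 2 * ((2 : ℝ) ^ k * z i - (-1 : ℝ) ^ k * ((α i : ℕ) : ℝ) / 3) + e := by
      rw [← he, zpow_add_one₀ (by norm_num), zpow_add_one₀ (by norm_num)]; ring
    simp only [gridN]
    rw [h1, Int.floor_add_intCast, add_sub_cancel_right]
    generalize (2 : ℝ) ^ k * z i - (-1 : ℝ) ^ k * ((α i : ℕ) : ℝ) / 3 = u
    have h2 : ⌊u⌋ = ⌊2 * u / ((2 : ℕ) : ℝ)⌋ := by congr 1; push_cast; ring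
    rw [h2, Int.floor_div_natCast]; rfl
  rw [key, key, hi]

lemma gridD_isGrid (α : Fin d → Fin 2) : IsGrid (gridD α) where
  mem k x := (mem_gridC α k _ x).2 rfl
  eq k x y h := by
    have := (mem_gridC α k _ y).1 h
    unfold gridD; rw [this]
  sub k x := by
    intro y hy
    exact (mem_gridC α k _ y).2 (gridN_succ α k x y ((mem_gridC α (k + 1) _ y).1 hy))
  side k x := rfl
  cnt := by
    refine (Set.countable_range (fun t : ℤ × (Fin d → ℤ) => gridC α t.1 t.2)).mono ?_
    rintro _ ⟨⟨k, x⟩, rfl⟩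
    exact ⟨(k, gridN α k x), rfl⟩

lemma grid_cover (Q : Cube d) : ∃ (α : Fin d → Fin 2) (k : ℤ), ∀ x ∈ Q.set,
    Q.set ⊆ (gridD α k x).set ∧ (gridD α k x).vol ≤ 6 ^ d * Q.vol := by
  obtain ⟨n, hn1, hn2⟩ := exists_mem_Ioc_zpow (x := 3 * Q.side) (y := 2)
    (by have := Q.side_pos; positivity) (by norm_num)
  set k : ℤ := -(n + 1) with hk
  have hw : (2 : ℝ) ^ (-k) = 2 * 2 ^ n := by
    rw [hk, neg_neg, zpow_add_one₀ (by norm_num)]; ring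
  have hpos : (0 : ℝ) < 2 ^ k := by positivity
  have hside : (2 : ℝ) ^ k * Q.side ≤ 1 / 3 := by
    have : (2 : ℝ) ^ k * (3 * Q.side) ≤ 2 ^ k * 2 ^ (n + 1) := by gcongr
    rw [← zpow_add₀ (by norm_num), hk, neg_add_cancel, zpow_zero] at this
    linarith
  have hcoord : ∀ i, ∃ (b : Fin 2) (N : ℤ), ∀ y ∈ Q.set,
      ⌊(2 : ℝ) ^ k * y i - (-1 : ℝ) ^ k * ((b : ℕ) : ℝ) / 3⌋ = N := by
    intro i
    set u := (2 : ℝ) ^ k * Q.corner i with hu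
    have hy : ∀ y ∈ Q.set, u ≤ (2 : ℝ) ^ k * y i ∧ (2 : ℝ) ^ k * y i < u + 1 / 3 := by
      intro y hy
      constructor
      · exact mul_le_mul_of_nonneg_left (hy i).1 hpos.le
      · have := mul_lt_mul_of_pos_left (hy i).2 hpos
        rw [mul_add] at this
        linarith
    have hf1 := Int.floor_le u
    have hf2 := Int.lt_floor_add_one u
    by_cases hc : u ≤ ⌊u⌋ + 2 / 3
    · refine ⟨0, ⌊u⌋, fun y hyQ => ?_⟩
      have := hy y hyQ
      rw [Int.floor_eq_iff]
      simp only [Fin.val_zero, Nat.cast_zero, mul_zero, zero_div, sub_zero]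
      constructor <;> linarith
    · push Not at hc
      rcases Int.even_or_odd k with he | ho
      · refine ⟨1, ⌊u⌋, fun y hyQ => ?_⟩
        have := hy y hyQ
        rw [Int.floor_eq_iff, he.neg_one_zpow]
        simp only [Fin.val_one, Nat.cast_one]
        constructor <;> linarith
      · refine ⟨1, ⌊u⌋ + 1, fun y hyQ => ?_⟩
        have := hy y hyQ
        rw [Int.floor_eq_iff, ho.neg_one_zpow]
        simp only [Fin.val_one, Nat.cast_one]
        push_cast
        constructor <;> linarith
  choose α N hN using hcoord
  refine ⟨α, k, fun x hx => ⟨fun y hy => ?_, ?_⟩⟩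
  · refine (mem_gridC α k _ y).2 ?_
    funext i
    exact (hN i y hy).trans (hN i x hx).symm
  · rw [Cube.vol_eq, Cube.vol_eq, ← mul_pow]
    refine pow_le_pow_left' ?_ d
    have : (6 : ℝ≥0∞) = ENNReal.ofReal 6 := by simp
    rw [this, ← ENNReal.ofReal_mul (by norm_num)]
    refine ENNReal.ofReal_le_ofReal ?_
    show (2 : ℝ) ^ (-k) ≤ _
    rw [hw]; linarith
end
section
variable {d : ℕ}

lemma part_one (A : Cube d → ℝ≥0∞) (q : ℝ) (hq : 0 < q) (S : Set (Cube d)) (hS : IsSparse S) :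
    ∑' Q : S, A (Q : Cube d) ^ q * (Q : Cube d).vol ≤
      2 * ∫⁻ x, (⨆ (Q : Cube d) (_ : x ∈ Q.set), A Q) ^ q := by
  obtain ⟨E, hE, hdisj⟩ := hS
  rw [ENNReal.tsum_eq_iSup_sum]
  refine iSup_le fun T => ?_
  set M : (Fin d → ℝ) → ℝ≥0∞ := fun x => (⨆ (Q : Cube d) (_ : x ∈ Q.set), A Q) ^ q with hM
  have hd2 : (T : Set S).PairwiseDisjoint fun Q => E (Q : Cube d) := by
    intro Q _ Q' _ hne
    exact hdisj Q.2 Q'.2 (fun h => hne (Subtype.ext h))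
  calc ∑ Q ∈ T, A (Q : Cube d) ^ q * (Q : Cube d).vol
      ≤ ∑ Q ∈ T, 2 * ∫⁻ x in E (Q : Cube d), M x := by
        refine Finset.sum_le_sum fun Q _ => ?_
        obtain ⟨h1, h2, h3⟩ := hE Q Q.2
        calc A (Q : Cube d) ^ q * (Q : Cube d).vol
            ≤ A (Q : Cube d) ^ q * (2 * volume (E (Q : Cube d))) := by gcongr
          _ = 2 * ∫⁻ x in E (Q : Cube d), A (Q : Cube d) ^ q := by
              rw [setLIntegral_const]; ring
          _ ≤ _ := by
              gcongr 2 * ?_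
              refine setLIntegral_mono' h1 fun x hx => ?_
              refine ENNReal.rpow_le_rpow ?_ hq.le
              exact le_iSup₂ (f := fun (Q : Cube d) (_ : x ∈ Q.set) => A Q) (Q : Cube d) (h2 hx)
    _ = 2 * ∫⁻ x in ⋃ Q ∈ T, E (Q : Cube d), M x := by
        rw [← Finset.mul_sum, lintegral_biUnion_finset hd2 fun Q _ => (hE Q Q.2).1]
    _ ≤ _ := by
        gcongr
        exact Measure.restrict_le_self

lemma part_two (hd : 1 ≤ d) {ι : Type*} [Fintype ι] [Nonempty ι] (p : ι → ℝ) (hp : ∀ j, 0 < p j)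
    (H : ι → (Fin d → ℝ) → ℝ≥0∞) (hH : ∀ j (Q : Cube d), ∫⁻ x in Q.set, H j x < ∞)
    (q : ℝ) (hq : 0 < q)
    (a : ℝ≥0∞) (ha : kap p (2 * (Fintype.card ι : ℝ≥0∞)) * kap p (2 ^ d) ≤ a) (ha1 : 1 < a)
    (hat : a ≠ ∞) :
    ∃ S : Set (Cube d), IsSparse S ∧
      ∫⁻ x, (⨆ (Q : Cube d) (_ : x ∈ Q.set), gA p H Q) ^ q ≤
      (kap p (6 ^ d) * a) ^ q * (2 ^ d * ∑' Q : S, gA p H (Q : Cube d) ^ q * (Q : Cube d).vol) := by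
  set K := kap p (6 ^ d) with hK
  have hK1 : 1 ≤ K := one_le_kap p hp _ (one_le_pow₀ (by norm_num))
  have hKa : 1 ≤ K * a := one_le_mul hK1 ha1.le
  by_cases hb : ∀ lam : ℝ≥0∞, 0 < lam → ∃ B : ℝ, ∀ Q : Cube d, lam < gA p H Q → Q.side ≤ B
  swap
  · push Not at hb
    obtain ⟨lam, hlam, hB⟩ := hb
    obtain ⟨S, hS, hsum⟩ := case_one hd (gA p H) lam hlam hB q hq
    refine ⟨S, hS, ?_⟩
    rw [hsum, ENNReal.mul_top (by simp), ENNReal.mul_top]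
    · exact le_top
    · exact (zero_lt_one.trans_le (ENNReal.one_le_rpow hKa hq)).ne'
  have hS := fun α : Fin d → Fin 2 => (gridD_isGrid α).exists_sparse hd p hp H hH hb a ha ha1 hat
  choose S hSc hSs hSd using hS
  set B : (Fin d → Fin 2) → ℝ≥0∞ := fun α =>
    ∑' Q : S α, gA p H (Q : Cube d) ^ q * (Q : Cube d).vol with hBdef
  obtain ⟨β, -, hβ⟩ := Finset.exists_max_image Finset.univ B Finset.univ_nonempty
  refine ⟨S β, hSs β, ?_⟩
  let W : (Fin d → ℝ) → ℝ≥0∞ := fun x => ∑ α, ∑' Q : S α,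
    (Q : Cube d).set.indicator (fun _ => (K * a) ^ q * gA p H (Q : Cube d) ^ q) x
  have hW : ∀ x, (⨆ (Q : Cube d) (_ : x ∈ Q.set), gA p H Q) ^ q ≤ W x := by
    intro x
    rw [← ENNReal.le_rpow_inv_iff hq]
    refine iSup₂_le fun Q hQ => ?_
    rw [ENNReal.le_rpow_inv_iff hq]
    obtain ⟨α, k, hcov⟩ := grid_cover Q
    obtain ⟨hsub, hvol⟩ := hcov x hQ
    have h1 : gA p H Q ≤ K * gA p H (gridD α k x) := gA_mono p hp H hsub hvol
    by_cases h0 : gA p H (gridD α k x) = 0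
    · rw [h0, mul_zero, nonpos_iff_eq_zero] at h1
      rw [h1, ENNReal.zero_rpow_of_pos hq]
      exact zero_le
    obtain ⟨Q', hQ', hx, hle⟩ := hSd α k x h0
    calc gA p H Q ^ q ≤ (K * a * gA p H Q') ^ q := by
          refine ENNReal.rpow_le_rpow (h1.trans ?_) hq.le
          rw [mul_assoc]; gcongr
      _ = Q'.set.indicator (fun _ => (K * a) ^ q * gA p H Q' ^ q) x := by
          rw [Set.indicator_of_mem hx, ENNReal.mul_rpow_of_nonneg _ _ hq.le]
      _ ≤ ∑' Q : S α,
          (Q : Cube d).set.indicator (fun _ => (K * a) ^ q * gA p H (Q : Cube d) ^ q) x :=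
          ENNReal.le_tsum (f := fun Q : S α =>
            (Q : Cube d).set.indicator (fun _ => (K * a) ^ q * gA p H (Q : Cube d) ^ q) x) ⟨Q', hQ'⟩
      _ ≤ W x := Finset.single_le_sum (f := fun α => ∑' Q : S α,
          (Q : Cube d).set.indicator (fun _ => (K * a) ^ q * gA p H (Q : Cube d) ^ q) x)
          (fun _ _ => zero_le) (Finset.mem_univ α)
  have hcnt : ∀ α, Countable (S α) := fun α => (hSc α).to_subtype
  have hmeas : ∀ α (Q : S α), Measurable
      ((Q : Cube d).set.indicator (fun _ : Fin d → ℝ => (K * a) ^ q * gA p H (Q : Cube d) ^ q)) :=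
    fun α Q => measurable_const.indicator (Q : Cube d).meas
  calc _ ≤ ∫⁻ x, W x := lintegral_mono hW
    _ = ∑ α, (K * a) ^ q * B α := by
        rw [lintegral_finsetSum _ fun α _ => Measurable.ennreal_tsum (hmeas α)]
        refine Finset.sum_congr rfl fun α _ => ?_
        rw [lintegral_tsum fun Q => (hmeas α Q).aemeasurable, hBdef, ← ENNReal.tsum_mul_left]
        refine tsum_congr fun Q => ?_
        rw [lintegral_indicator_const (Q : Cube d).meas, mul_assoc]; rfl
    _ ≤ ∑ _α : Fin d → Fin 2, (K * a) ^ q * B β := by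
        refine Finset.sum_le_sum fun α hα => ?_
        gcongr
        exact hβ α hα
    _ = _ := by
        simp only [Finset.sum_const, Finset.card_univ, Fintype.card_pi, Fintype.card_fin,
          Finset.prod_const, nsmul_eq_mul]
        push_cast
        rw [hBdef]; ring
end

/-- equivalence between sparse forms and the `L^q` norm of the
multisublinear Hardy–Littlewood maximal operator. -/
theorem statement1 (d m : ℕ) (hd : 1 ≤ d) (hm : 1 ≤ m)
    (r : Fin m → ℝ≥0∞) (hr : ∀ j, 0 < r j ∧ r j ≠ ∞)
    (q s : ℝ≥0∞) (hq : 0 < q) (hq' : q ≠ ∞) (hqs : q < s) :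
    ∃ C : ℝ≥0∞, 0 < C ∧ C ≠ ∞ ∧
      ∀ (f : Fin m → (Fin d → ℝ) → ℂ) (g : (Fin d → ℝ) → ℂ),
        (∀ j, Measurable (f j)) →
        (∀ j (Q : Cube d), ∫⁻ x in Q.set, nn (f j) x ^ (r j).toReal < ∞) →
        Measurable g →
        (∀ Q : Cube d, ∫⁻ x in Q.set, nn g x ^ ((q⁻¹ - s⁻¹)⁻¹).toReal < ∞) →
        -- (i) every sparse form is dominated by the L^q norm of the maximal operator
        ((∀ S : Set (Cube d), IsSparse S →
            (∑' Q : S, (∏ j, avg (r j) (nn (f j)) (Q : Cube d)) ^ q.toReal *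
                avg (q⁻¹ - s⁻¹)⁻¹ (nn g) (Q : Cube d) ^ q.toReal *
                (Q : Cube d).vol) ^ (1 / q.toReal) ≤
              C * eNorm q volume
                (maximalX r (q⁻¹ - s⁻¹)⁻¹ (fun j => nn (f j)) (nn g))) ∧
        -- (ii) the L^q norm of the maximal operator is dominated by some sparse form
          (∃ S : Set (Cube d), IsSparse S ∧
            eNorm q volume (maximalX r (q⁻¹ - s⁻¹)⁻¹ (fun j => nn (f j)) (nn g)) ≤
              C * (∑' Q : S, (∏ j, avg (r j) (nn (f j)) (Q : Cube d)) ^ q.toReal *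
                  avg (q⁻¹ - s⁻¹)⁻¹ (nn g) (Q : Cube d) ^ q.toReal *
                  (Q : Cube d).vol) ^ (1 / q.toReal))) := by
  set ρ := (q⁻¹ - s⁻¹)⁻¹ with hρ
  have hq0 : 0 < q.toReal := ENNReal.toReal_pos hq.ne' hq'
  have hlt : s⁻¹ < q⁻¹ := ENNReal.inv_lt_inv.2 hqs
  have hρt : ρ ≠ ∞ := by
    rw [hρ, ENNReal.inv_ne_top]; exact (tsub_pos_of_lt hlt).ne'
  have hρ0 : 0 < ρ := by
    rw [hρ, ENNReal.inv_pos]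
    exact ((tsub_le_self).trans_lt (ENNReal.inv_lt_top.2 hq)).ne
  let R : Fin (m + 1) → ℝ≥0∞ := Fin.cons ρ r
  let p : Fin (m + 1) → ℝ := fun j => (R j).toReal
  have hp : ∀ j, 0 < p j := by
    intro j
    refine Fin.cases ?_ (fun i => ?_) j
    · exact ENNReal.toReal_pos hρ0.ne' hρt
    · exact ENNReal.toReal_pos (hr i).1.ne' (hr i).2
  set b : ℝ≥0∞ := kap p (2 * (Fintype.card (Fin (m + 1)) : ℝ≥0∞)) * kap p (2 ^ d) with hb
  have hbt : b ≠ ∞ := ENNReal.mul_ne_top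
    (kap_ne_top p hp _ (ENNReal.mul_ne_top (by simp) (by simp)))
    (kap_ne_top p hp _ (ENNReal.pow_ne_top (by simp)))
  set a : ℝ≥0∞ := b + 2 with ha
  have hat : a ≠ ∞ := by simp [ha, hbt]
  have ha1 : 1 < a := lt_of_lt_of_le (by norm_num) (le_add_self : (2 : ℝ≥0∞) ≤ b + 2)
  set K := kap p (6 ^ d) with hK
  have hK1 : 1 ≤ K := one_le_kap p hp _ (one_le_pow₀ (by norm_num))
  have hKt : K ≠ ∞ := kap_ne_top p hp _ (ENNReal.pow_ne_top (by simp))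
  have hKa : 1 ≤ K * a := one_le_mul hK1 ha1.le
  have hiq : 0 < 1 / q.toReal := one_div_pos.2 hq0
  have hz : (2 : ℝ≥0∞) ≤ 2 ^ d + 2 := le_add_self
  refine ⟨K * a * (2 ^ d + 2) ^ (1 / q.toReal), ?_, ?_, ?_⟩
  · exact zero_lt_one.trans_le (one_le_mul hKa (ENNReal.one_le_rpow
      (le_trans (by norm_num) hz) hiq))
  · exact ENNReal.mul_ne_top (ENNReal.mul_ne_top hKt hat)
      (ENNReal.rpow_ne_top_of_nonneg hiq.le (by simp))
  intro f g hf hfi hg hgi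
  let F : Fin (m + 1) → (Fin d → ℝ) → ℝ≥0∞ := Fin.cons (nn g) (fun j => nn (f j))
  let H : Fin (m + 1) → (Fin d → ℝ) → ℝ≥0∞ := fun j x => F j x ^ p j
  have hH : ∀ j (Q : Cube d), ∫⁻ x in Q.set, H j x < ∞ := by
    intro j Q
    refine Fin.cases ?_ (fun i => ?_) j
    · exact hgi Q
    · exact hfi i Q
  have hA : ∀ Q : Cube d, (∏ j, avg (r j) (nn (f j)) Q) * avg ρ (nn g) Q = gA p H Q := by
    intro Q
    unfold gA
    rw [Fin.prod_univ_succ, mul_comm]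
    congr 1
    · simp only [avg, if_neg hρt]; rfl
    · refine Finset.prod_congr rfl fun i _ => ?_
      simp only [avg, if_neg (hr i).2]; rfl
  have hM : eNorm q volume (maximalX r ρ (fun j => nn (f j)) (nn g)) =
      (∫⁻ x, (⨆ (Q : Cube d) (_ : x ∈ Q.set), gA p H Q) ^ q.toReal) ^ (1 / q.toReal) := by
    simp only [eNorm, if_neg hq', maximalX, hA]
  have hT : ∀ Q : Cube d, (∏ j, avg (r j) (nn (f j)) Q) ^ q.toReal * avg ρ (nn g) Q ^ q.toReal *
      Q.vol = gA p H Q ^ q.toReal * Q.vol := by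
    intro Q
    rw [← hA, ENNReal.mul_rpow_of_nonneg _ _ hq0.le]
  rw [hM]
  simp only [hT]
  constructor
  · intro S hS
    calc _ ≤ (2 * ∫⁻ x, (⨆ (Q : Cube d) (_ : x ∈ Q.set), gA p H Q) ^ q.toReal) ^ (1 / q.toReal) :=
          ENNReal.rpow_le_rpow (part_one (gA p H) q.toReal hq0 S hS) hiq.le
      _ = 1 * 2 ^ (1 / q.toReal) *
          (∫⁻ x, (⨆ (Q : Cube d) (_ : x ∈ Q.set), gA p H Q) ^ q.toReal) ^ (1 / q.toReal) := by
          rw [ENNReal.mul_rpow_of_nonneg _ _ hiq.le, one_mul]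
      _ ≤ _ := by gcongr
  · obtain ⟨S, hS, hle⟩ := part_two hd p hp H hH q.toReal hq0 a le_self_add ha1 hat
    refine ⟨S, hS, ?_⟩
    refine (ENNReal.rpow_le_rpow hle hiq.le).trans ?_
    rw [ENNReal.mul_rpow_of_nonneg _ _ hiq.le, ENNReal.mul_rpow_of_nonneg _ _ hiq.le,
      ← ENNReal.rpow_mul, mul_one_div_cancel hq0.ne', ENNReal.rpow_one, ← mul_assoc]
    gcongr
    exact le_self_add

end
end

section
/- Let d, m ≥ 1, r⃗ ∈ (0,∞)^m and p⃗ ∈ (0,∞]^m with r_j < p_j for all j, and set 1/p := ∑_{j=1}^m 1/p_j. There is a constant C depending only on d, m, p⃗, r⃗ such that for every vector of weights w⃗ ∈ A_{p⃗,(r⃗,∞)} and all measurable f_j : ℝ^d → ℂ (1 ≤ j ≤ m), ‖M_{r⃗}(f_1,…,f_m)‖_{L^p_w(ℝ^d)} ≤ C · [w⃗]_{p⃗,(r⃗,∞)}^{max_{1≤j≤m} (1/r_j)/(1/r_j − 1/p_j)} · ∏_{j=1}^m ‖f_j‖_{L^{p_j}_{w_j}(ℝ^d)}, where w := ∏_{j=1}^m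 w_j. -/
open MeasureTheory ENNReal

noncomputable section

/-- Centered maximal function with rational radii. -/
def MC {d : ℕ} (μ : Measure (Fin d → ℝ)) (g : (Fin d → ℝ) → ℝ≥0∞) (x : Fin d → ℝ) : ℝ≥0∞ :=
  ⨆ ρ : {q : ℚ // 0 < q},
    (∫⁻ y in Metric.closedBall x ((ρ : ℚ) : ℝ), g y ∂μ) / μ (Metric.closedBall x ((ρ : ℚ) : ℝ))

theorem measurable_ball_lintegral {d : ℕ} (μ : Measure (Fin d → ℝ)) [SFinite μ]
    {g : (Fin d → ℝ) → ℝ≥0∞} (hg : Measurable g) (ρ : ℝ) :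
    Measurable fun x => ∫⁻ y in Metric.closedBall x ρ, g y ∂μ := by
  have h : ∀ x, ∫⁻ y in Metric.closedBall x ρ, g y ∂μ
      = ∫⁻ y, {z : (Fin d → ℝ) × (Fin d → ℝ) | dist z.2 z.1 ≤ ρ}.indicator
          (fun z => g z.2) (x, y) ∂μ := by
    intro x
    rw [← lintegral_indicator Metric.isClosed_closedBall.measurableSet]
    rfl
  simp_rw [h]
  apply Measurable.lintegral_prod_right'
  apply Measurable.indicator (hg.comp measurable_snd)
  exact measurableSet_le (measurable_snd.dist measurable_fst) measurable_const

theorem measurable_MC {d : ℕ} (μ : Measure (Fin d → ℝ)) [SFinite μ]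
    {g : (Fin d → ℝ) → ℝ≥0∞} (hg : Measurable g) : Measurable (MC μ g) := by
  unfold MC
  apply Measurable.iSup
  intro ρ
  apply (measurable_ball_lintegral μ hg _).div
  simpa using measurable_ball_lintegral μ (measurable_const (a := (1:ℝ≥0∞))) ρ

theorem MC_weak (d : ℕ) : ∃ N : ℕ, ∀ (μ : Measure (Fin d → ℝ)) (g : (Fin d → ℝ) → ℝ≥0∞)
    (l : ℝ≥0∞), l * μ {x | l < MC μ g x} ≤ N * ∫⁻ x, g x ∂μ := by
  obtain ⟨N, τ, hτ, hN⟩ := HasBesicovitchCovering.no_satelliteConfig (α := Fin d → ℝ)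
  refine ⟨N, fun μ g l => ?_⟩
  let E : ℕ → Set (Fin d → ℝ) := fun n => {x | ∃ ρ : {q : ℚ // 0 < q}, ((ρ : ℚ) : ℝ) ≤ n ∧
    l < (∫⁻ y in Metric.closedBall x ((ρ : ℚ) : ℝ), g y ∂μ) /
      μ (Metric.closedBall x ((ρ : ℚ) : ℝ))}
  have hE : {x | l < MC μ g x} = ⋃ n, E n := by
    ext x
    simp only [MC, lt_iSup_iff, Set.mem_ofPred_eq, Set.mem_iUnion, E]
    constructor
    · rintro ⟨ρ, h⟩
      obtain ⟨n, hn⟩ := exists_nat_ge ((ρ : ℚ) : ℝ)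
      exact ⟨n, ρ, hn, h⟩
    · rintro ⟨n, ρ, _, h⟩
      exact ⟨ρ, h⟩
  have hmono : Monotone E := by
    intro a b hab x ⟨ρ, h1, h2⟩
    exact ⟨ρ, h1.trans (by exact_mod_cast hab), h2⟩
  have key : ∀ n, l * μ (E n) ≤ N * ∫⁻ x, g x ∂μ := by
    intro n
    have : ∀ x : E n, ∃ ρ : {q : ℚ // 0 < q}, ((ρ : ℚ) : ℝ) ≤ n ∧
      l < (∫⁻ y in Metric.closedBall x.1 ((ρ : ℚ) : ℝ), g y ∂μ) /
      μ (Metric.closedBall x.1 ((ρ : ℚ) : ℝ)) := fun x => x.2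
    choose ρ h1 h2 using this
    let q : Besicovitch.BallPackage (E n) (Fin d → ℝ) :=
      { c := fun x => x.1
        r := fun x => ((ρ x : ℚ) : ℝ)
        rpos := fun x => by exact_mod_cast (ρ x).2
        r_bound := n
        r_le := h1 }
    obtain ⟨s, hs1, hs2⟩ := Besicovitch.exist_disjoint_covering_families hτ hN q
    have hcount : ∀ i, (s i).Countable := by
      intro i
      refine (hs1 i).countable_of_nonempty_interior fun j _ => ?_
      have : (Metric.ball (q.c j) (q.r j)).Nonempty := Metric.nonempty_ball.2 (q.rpos _)
      exact this.mono Metric.ball_subset_interior_closedBall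
    have hcov : E n ⊆ ⋃ i : Fin N, ⋃ j ∈ s i, Metric.closedBall (q.c j) (q.r j) := by
      intro x hx
      have := hs2 (Set.mem_range_self (⟨x, hx⟩ : E n))
      simp only [Set.mem_iUnion] at this ⊢
      obtain ⟨i, j, hj, h⟩ := this
      exact ⟨i, j, hj, Metric.ball_subset_closedBall h⟩
    calc l * μ (E n) ≤ l * ∑ i : Fin N, ∑' j : s i, μ (Metric.closedBall (q.c j) (q.r j)) := by
          gcongr
          refine (measure_mono hcov).trans ((measure_iUnion_le _).trans ?_)
          rw [tsum_fintype]
          gcongr with i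
          exact measure_biUnion_le μ (hcount i) _
      _ = ∑ i : Fin N, ∑' j : s i, l * μ (Metric.closedBall (q.c j) (q.r j)) := by
          rw [Finset.mul_sum]
          simp_rw [ENNReal.tsum_mul_left]
      _ ≤ ∑ i : Fin N, ∑' j : s i, ∫⁻ y in Metric.closedBall (q.c j) (q.r j), g y ∂μ := by
          gcongr with i _ j
          exact ENNReal.mul_le_of_le_div (h2 j).le
      _ ≤ ∑ i : Fin N, ∫⁻ y, g y ∂μ := by
          gcongr with i _
          rw [← lintegral_biUnion (hcount i)
            (fun j _ => Metric.isClosed_closedBall.measurableSet) (hs1 i)]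
          exact setLIntegral_le_lintegral _ _
      _ = _ := by simp
  rw [hE, hmono.measure_iUnion, ENNReal.mul_iSup]
  exact iSup_le key

theorem MC_weak' (d : ℕ) : ∃ N : ℕ, ∀ (μ : Measure (Fin d → ℝ)) (g : (Fin d → ℝ) → ℝ≥0∞),
    Measurable g → ∀ (l : ℝ≥0∞), l ≠ ∞ → l * μ {x | l < MC μ g x} ≤
      2 * N * ∫⁻ x, g x * {x | l < 2 * g x}.indicator 1 x ∂μ := by
  obtain ⟨N, hN⟩ := MC_weak d
  refine ⟨N, fun μ g hg l hl => ?_⟩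
  set g' : (Fin d → ℝ) → ℝ≥0∞ := fun x => g x * {x | l < 2 * g x}.indicator 1 x
  have hle : ∀ x, g x ≤ g' x + l / 2 := by
    intro x
    by_cases h : l < 2 * g x
    · simp [g', h]
    · have : g x ≤ l / 2 := by
        rw [ENNReal.le_div_iff_mul_le (by simp) (by simp), mul_comm]; exact not_lt.1 h
      exact this.trans le_add_self
  have hsub : {x | l < MC μ g x} ⊆ {x | l / 2 < MC μ g' x} := by
    intro x hx
    simp only [Set.mem_ofPred_eq] at hx ⊢
    by_contra! hcon
    refine absurd hx (not_lt.2 ?_)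
    have : MC μ g x ≤ MC μ g' x + l / 2 := by
      refine iSup_le fun ρ => ?_
      calc _ ≤ (∫⁻ y in Metric.closedBall x ((ρ : ℚ) : ℝ), (g' y + l / 2) ∂μ)
              / μ (Metric.closedBall x ((ρ : ℚ) : ℝ)) := by
            gcongr with y; exact hle y
        _ = (∫⁻ y in Metric.closedBall x ((ρ : ℚ) : ℝ), g' y ∂μ)
              / μ (Metric.closedBall x ((ρ : ℚ) : ℝ))
            + (l / 2 * μ (Metric.closedBall x ((ρ : ℚ) : ℝ)))
              / μ (Metric.closedBall x ((ρ : ℚ) : ℝ)) := by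
            rw [lintegral_add_right _ measurable_const, ENNReal.add_div]
            simp
        _ ≤ _ := by
            refine add_le_add ?_ ?_
            · exact le_iSup (fun ρ : {q : ℚ // 0 < q} =>
                (∫⁻ y in Metric.closedBall x ((ρ : ℚ) : ℝ), g' y ∂μ)
                  / μ (Metric.closedBall x ((ρ : ℚ) : ℝ))) ρ
            · exact ENNReal.div_le_of_le_mul le_rfl
    calc _ ≤ l / 2 + l / 2 := this.trans (by gcongr)
      _ = l := ENNReal.add_halves l
  calc l * μ {x | l < MC μ g x} ≤ l * μ {x | l / 2 < MC μ g' x} := by gcongr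
    _ = 2 * (l / 2 * μ {x | l / 2 < MC μ g' x}) := by
        rw [← mul_assoc, ENNReal.mul_div_cancel (by simp) (by simp)]
    _ ≤ 2 * (N * ∫⁻ x, g' x ∂μ) := mul_le_mul_right (hN _ _ _) _
    _ = _ := by rw [mul_assoc]

theorem layer (s : ℝ) (hs : 0 < s) (t : ℝ≥0∞) :
    ∫⁻ l in Set.Ioi (0:ℝ), ENNReal.ofReal (l ^ (s - 1)) *
      {l : ℝ | ENNReal.ofReal l < t}.indicator 1 l = ENNReal.ofReal (1 / s) * t ^ s := by
  have fin : ∀ T : ℝ, 0 ≤ T → ∫⁻ l in Set.Ioi (0:ℝ), ENNReal.ofReal (l ^ (s - 1)) *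
      {l : ℝ | ENNReal.ofReal l < ENNReal.ofReal T}.indicator 1 l
      = ENNReal.ofReal (1 / s) * (ENNReal.ofReal T) ^ s := by
    intro T hT
    have h1 : ∫⁻ l in Set.Ioi (0:ℝ), ENNReal.ofReal (l ^ (s - 1)) *
      {l : ℝ | ENNReal.ofReal l < ENNReal.ofReal T}.indicator 1 l
      = ∫⁻ l in Set.Ioo 0 T, ENNReal.ofReal (l ^ (s - 1)) := by
      rw [← lintegral_indicator measurableSet_Ioi, ← lintegral_indicator measurableSet_Ioo]
      congr 1
      ext l
      by_cases h0 : 0 < l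
      · by_cases hl : l < T
        · have : ENNReal.ofReal l < ENNReal.ofReal T := (ENNReal.ofReal_lt_ofReal_iff (h0.trans hl)).2 hl
          simp [h0, hl, this]
        · have : ENNReal.ofReal T ≤ ENNReal.ofReal l := ENNReal.ofReal_le_ofReal (not_lt.1 hl)
          simp [h0, hl, this]
      · simp [h0]
    rw [h1, restrict_Ioo_eq_restrict_Ioc, ← ofReal_integral_eq_lintegral_ofReal,
      ← intervalIntegral.integral_of_le hT, integral_rpow (Or.inl (by linarith)),
      ENNReal.ofReal_rpow_of_nonneg hT hs.le, ← ENNReal.ofReal_mul (by positivity)]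
    · congr 1
      rw [sub_add_cancel, Real.zero_rpow hs.ne']
      ring
    · have := (intervalIntegral.intervalIntegrable_rpow' (a := 0) (b := T) (r := s - 1) (by linarith))
      exact (intervalIntegrable_iff_integrableOn_Ioc_of_le hT).1 this
    · filter_upwards [self_mem_ae_restrict measurableSet_Ioc] with l hl
      exact Real.rpow_nonneg hl.1.le _
  rcases eq_or_ne t ∞ with rfl | ht
  · rw [ENNReal.top_rpow_of_pos hs, ENNReal.mul_top (by simpa using hs)]
    rw [eq_top_iff]
    have h : ∀ n : ℕ, ENNReal.ofReal (1 / s) * (n : ℝ≥0∞) ^ s ≤ ∫⁻ l in Set.Ioi (0:ℝ),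
        ENNReal.ofReal (l ^ (s - 1)) * {l : ℝ | ENNReal.ofReal l < ∞}.indicator 1 l := by
      intro n
      have := fin n (by positivity)
      rw [ENNReal.ofReal_natCast] at this
      rw [← this]
      gcongr with l
      exact le_top
    have htend : Filter.Tendsto (fun n : ℕ => ENNReal.ofReal (1 / s) * (n : ℝ≥0∞) ^ s)
        Filter.atTop (nhds ∞) := by
      have h1 : Filter.Tendsto (fun n : ℕ => (n : ℝ≥0∞) ^ s) Filter.atTop (nhds ∞) := by
        have := (ENNReal.continuous_rpow_const (y := s)).tendsto ∞
        rw [ENNReal.top_rpow_of_pos hs] at this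
        exact this.comp ENNReal.tendsto_nat_nhds_top
      have h2 := ENNReal.Tendsto.const_mul (a := ENNReal.ofReal (1 / s)) h1 (Or.inl (by simp))
      rwa [ENNReal.mul_top (by simpa using hs)] at h2
    exact le_of_tendsto' htend h
  · have := fin t.toReal ENNReal.toReal_nonneg
    rwa [ENNReal.ofReal_toReal ht] at this

theorem MC_strong (d : ℕ) (q : ℝ) (hq : 1 < q) : ∃ C : ℝ≥0∞, C ≠ ∞ ∧
    ∀ (μ : Measure (Fin d → ℝ)) [SFinite μ] (g : (Fin d → ℝ) → ℝ≥0∞), Measurable g →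
      ∫⁻ x, MC μ g x ^ q ∂μ ≤ C * ∫⁻ x, g x ^ q ∂μ := by
  obtain ⟨N, hN⟩ := MC_weak' d
  refine ⟨ENNReal.ofReal q * (2 * N * (ENNReal.ofReal (1 / (q - 1)) * 2 ^ (q - 1))), ?_,
    fun μ _ g hg => ?_⟩
  · have : (2:ℝ≥0∞) ^ (q - 1) ≠ ∞ := by simp
    finiteness
  have hM := measurable_MC μ hg
  have hq0 : ENNReal.ofReal q * ENNReal.ofReal (1 / q) = 1 := by
    rw [← ENNReal.ofReal_mul (by linarith)]; field_simp; simp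
  calc ∫⁻ x, MC μ g x ^ q ∂μ
      = ∫⁻ x, ENNReal.ofReal q * (∫⁻ l in Set.Ioi (0:ℝ), ENNReal.ofReal (l ^ (q - 1)) *
          {l : ℝ | ENNReal.ofReal l < MC μ g x}.indicator 1 l) ∂μ := by
        congr 1; ext x
        rw [layer q (by linarith), ← mul_assoc, hq0, one_mul]
    _ = ENNReal.ofReal q * ∫⁻ l in Set.Ioi (0:ℝ), ENNReal.ofReal (l ^ (q - 1)) *
          μ {x | ENNReal.ofReal l < MC μ g x} := by
        rw [lintegral_const_mul' _ _ (by simp), lintegral_lintegral_swap]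
        · congr 2; ext l
          rw [lintegral_const_mul' _ _ (by simp)]
          congr 1
          rw [← lintegral_indicator_one (measurableSet_lt measurable_const hM)]
          rfl
        · apply Measurable.aemeasurable
          apply Measurable.mul
          · fun_prop
          · exact (measurable_one.indicator (measurableSet_lt
              (f := fun z : (Fin d → ℝ) × ℝ => ENNReal.ofReal z.2) (by fun_prop)
              (hM.comp measurable_fst)))
    _ ≤ ENNReal.ofReal q * ∫⁻ l in Set.Ioi (0:ℝ), ENNReal.ofReal (l ^ (q - 1 - 1)) *
          (2 * N * ∫⁻ x, g x * {x | ENNReal.ofReal l < 2 * g x}.indicator 1 x ∂μ) := by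
        gcongr 1
        apply setLIntegral_mono' measurableSet_Ioi
        intro l hl
        have hl : 0 < l := hl
        rw [Real.rpow_sub_one hl.ne' (q-1), div_eq_mul_inv, ENNReal.ofReal_mul (by positivity), mul_assoc]
        gcongr
        have := hN μ g hg (ENNReal.ofReal l) (by simp)
        rw [ENNReal.ofReal_inv_of_pos hl, mul_comm _⁻¹, ← div_eq_mul_inv,
          ENNReal.le_div_iff_mul_le (by simp [hl]) (by simp), mul_comm]
        exact this
    _ = ENNReal.ofReal q * (2 * N * ∫⁻ x, g x * (∫⁻ l in Set.Ioi (0:ℝ),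
          ENNReal.ofReal (l ^ (q - 1 - 1)) *
          {l : ℝ | ENNReal.ofReal l < 2 * g x}.indicator 1 l) ∂μ) := by
        congr 1
        have : ∀ l : ℝ, ENNReal.ofReal (l ^ (q - 1 - 1)) *
          (2 * N * ∫⁻ x, g x * {x | ENNReal.ofReal l < 2 * g x}.indicator 1 x ∂μ)
          = 2 * N * ∫⁻ x, g x * (ENNReal.ofReal (l ^ (q - 1 - 1)) *
            {l : ℝ | ENNReal.ofReal l < 2 * g x}.indicator 1 l) ∂μ := by
          intro l
          rw [mul_left_comm, ← lintegral_const_mul' _ _ (by simp)]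
          congr 2; ext x
          rw [mul_left_comm]
          rfl
        simp_rw [this]
        rw [lintegral_const_mul' _ _ (by finiteness), lintegral_lintegral_swap]
        · congr 2; ext x
          rw [lintegral_const_mul]
          apply Measurable.mul
          · fun_prop
          · exact (measurable_one.indicator (measurableSet_lt
              (f := fun z : ℝ => ENNReal.ofReal z) (by fun_prop) measurable_const))
        · apply Measurable.aemeasurable
          apply Measurable.mul
          · fun_prop
          apply Measurable.mul
          · fun_prop
          · exact (measurable_one.indicator (measurableSet_lt
              (f := fun z : ℝ × (Fin d → ℝ) => ENNReal.ofReal z.1) (by fun_prop)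
              ((hg.comp measurable_snd).const_mul 2)))
    _ = ENNReal.ofReal q * (2 * N * (ENNReal.ofReal (1 / (q - 1)) * 2 ^ (q - 1) *
          ∫⁻ x, g x ^ q ∂μ)) := by
        congr 2
        rw [← lintegral_const_mul' _ _ (by finiteness)]
        apply lintegral_congr; intro x
        rw [layer (q - 1) (by linarith), ENNReal.mul_rpow_of_nonneg _ _ (by linarith)]
        have : g x ^ q = g x * g x ^ (q - 1) := by
          conv_lhs => rw [show q = 1 + (q - 1) by ring]
          rw [ENNReal.rpow_add_of_nonneg _ _ zero_le_one (by linarith), ENNReal.rpow_one]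
        rw [this]; ring
    _ = _ := by ring

theorem rpow_sum_aux {ι : Type*} (s : Finset ι) (e : ι → ℝ) {x : ℝ≥0∞} (h0 : x ≠ 0) (ht : x ≠ ∞) :
    ∏ i ∈ s, x ^ e i = x ^ ∑ i ∈ s, e i := by
  classical
  induction s using Finset.induction with
  | empty => simp
  | insert i s hi ih => rw [Finset.prod_insert hi, Finset.sum_insert hi, ih, ENNReal.rpow_add _ _ h0 ht]

namespace Cube
theorem set_eq_s3 {d : ℕ} (Q : Cube d) :
    Q.set = Set.univ.pi fun i => Set.Ico (Q.corner i) (Q.corner i + Q.side) := by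
  ext x; simp [Cube.set]

theorem measurableSet {d : ℕ} (Q : Cube d) : MeasurableSet Q.set := by
  rw [set_eq_s3]; exact MeasurableSet.univ_pi fun i => measurableSet_Ico

theorem vol_eq_s3 {d : ℕ} (Q : Cube d) : Q.vol = ENNReal.ofReal Q.side ^ d := by
  rw [vol, set_eq_s3, Real.volume_pi_Ico]; simp

theorem vol_ne_zero_s3 {d : ℕ} (Q : Cube d) : Q.vol ≠ 0 := by
  rw [vol_eq_s3]; exact pow_ne_zero _ (by simpa using Q.side_pos)

theorem vol_ne_top_s3 {d : ℕ} (Q : Cube d) : Q.vol ≠ ∞ := by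
  rw [vol_eq_s3]; finiteness

/-- The five-fold dilation of a cube. -/
def five {d : ℕ} (Q : Cube d) : Cube d where
  corner := fun i => Q.corner i - 2 * Q.side
  side := 5 * Q.side
  side_pos := by have := Q.side_pos; positivity

theorem vol_five {d : ℕ} (Q : Cube d) : Q.five.vol = 5 ^ d * Q.vol := by
  rw [vol_eq_s3, vol_eq_s3, five, ENNReal.ofReal_mul (by norm_num), mul_pow]; simp

theorem sub_five {d : ℕ} (Q : Cube d) : Q.set ⊆ Q.five.set := by
  intro x hx i
  have := hx i
  have := Q.side_pos
  simp only [five]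
  constructor <;> linarith [hx i]

theorem ball_between {d : ℕ} (Q : Cube d) : ∃ ρ : {q : ℚ // 0 < q}, ∀ x ∈ Q.set,
    Q.set ⊆ Metric.closedBall x ((ρ : ℚ) : ℝ) ∧
    Metric.closedBall x ((ρ : ℚ) : ℝ) ⊆ Q.five.set := by
  have hs := Q.side_pos
  obtain ⟨ρ, h1, h2⟩ := exists_rat_btwn (show Q.side < 2 * Q.side by linarith)
  have hρ : (0:ℝ) < ρ := hs.trans h1
  refine ⟨⟨ρ, by exact_mod_cast hρ⟩, fun x hx => ⟨fun y hy => ?_, fun y hy => ?_⟩⟩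
  · rw [Metric.mem_closedBall, dist_pi_le_iff hρ.le]
    intro i
    rw [Real.dist_eq, abs_le]
    have := hx i
    have := hy i
    constructor <;> linarith [hx i, hy i]
  · rw [Metric.mem_closedBall, dist_pi_le_iff hρ.le] at hy
    intro i
    have h3 := hy i
    rw [Real.dist_eq, abs_le] at h3
    have := hx i
    simp only [five] at h3 ⊢
    constructor <;> linarith [hx i, h3.1, h3.2]
end Cube

/-- density version of the centered maximal function -/
def MD {d : ℕ} (u G : (Fin d → ℝ) → ℝ≥0∞) : (Fin d → ℝ) → ℝ≥0∞ :=
  MC (volume.withDensity u) (fun x => G x / u x)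

theorem measurable_MD {d : ℕ} {u G : (Fin d → ℝ) → ℝ≥0∞} (hu : Measurable u) (hG : Measurable G) :
    Measurable (MD u G) := measurable_MC _ (hG.div hu)

theorem setLIntegral_MD {d : ℕ} {u G : (Fin d → ℝ) → ℝ≥0∞} (hu : Measurable u) (hG : Measurable G)
    (hu0 : ∀ x, u x ≠ 0) (hut : ∀ x, u x ≠ ∞) {s : Set (Fin d → ℝ)} (hs : MeasurableSet s) :
    ∫⁻ x in s, G x / u x ∂(volume.withDensity u) = ∫⁻ x in s, G x := by
  have hGu : Measurable fun x => G x / u x := hG.div hu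
  rw [setLIntegral_withDensity_eq_setLIntegral_mul _ hu hGu hs]
  congr 1; ext x
  exact ENNReal.mul_div_cancel (hu0 x) (hut x)

theorem MD_ge {d : ℕ} {u G : (Fin d → ℝ) → ℝ≥0∞} (hu : Measurable u) (hG : Measurable G)
    (hu0 : ∀ x, u x ≠ 0) (hut : ∀ x, u x ≠ ∞) (Q : Cube d) {x : Fin d → ℝ} (hx : x ∈ Q.set) :
    (∫⁻ y in Q.set, G y) / (∫⁻ y in Q.five.set, u y) ≤ MD u G x := by
  obtain ⟨ρ, hρ⟩ := Q.ball_between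
  obtain ⟨h1, h2⟩ := hρ x hx
  refine le_trans ?_ (le_iSup _ ρ)
  have hm : MeasurableSet (Metric.closedBall x ((ρ : ℚ) : ℝ)) :=
    Metric.isClosed_closedBall.measurableSet
  rw [setLIntegral_MD hu hG hu0 hut hm, withDensity_apply _ hm]
  exact ENNReal.div_le_div (lintegral_mono_set h1) (lintegral_mono_set h2)

theorem MD_strong (d : ℕ) (q : ℝ) (hq : 1 < q) : ∃ C : ℝ≥0∞, C ≠ ∞ ∧
    ∀ (u G : (Fin d → ℝ) → ℝ≥0∞), Measurable u → Measurable G →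
      ∫⁻ x, MD u G x ^ q * u x ≤ C * ∫⁻ x, (G x / u x) ^ q * u x := by
  obtain ⟨C, hC, h⟩ := MC_strong d q hq
  refine ⟨C, hC, fun u G hu hG => ?_⟩
  have hGu : Measurable fun x => G x / u x := hG.div hu
  have := h (volume.withDensity u) (fun x => G x / u x) hGu
  rw [lintegral_withDensity_eq_lintegral_mul _ hu ((measurable_MC _ hGu).pow_const q),
    lintegral_withDensity_eq_lintegral_mul _ hu (hGu.pow_const q)] at this
  simpa only [Pi.mul_apply, mul_comm (u _), MD] using this

theorem lint_pos {d : ℕ} {u : (Fin d → ℝ) → ℝ≥0∞} (hu : Measurable u)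
    (hu0 : ∀ x, u x ≠ 0) (Q : Cube d) : ∫⁻ y in Q.set, u y ≠ 0 := by
  apply ne_of_gt
  rw [setLIntegral_pos_iff hu]
  have : Function.support u = Set.univ := by ext x; simp [hu0 x]
  rw [this, Set.univ_inter]
  exact pos_iff_ne_zero.2 Q.vol_ne_zero_s3

/-- Pointwise step. -/
theorem pointwise_step {d m : ℕ} (c i β : Fin m → ℝ) (B γ : ℝ) (hB : 0 < B) (hγ : 0 < γ)
    (hi : ∀ j, 0 ≤ i j)
    (hβ : ∀ j, 0 ≤ β j) (hcβ : ∀ j, β j = γ * c j - i j) (hN : ∑ j, c j + B = ∑ j, i j)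
    (σ : Fin m → (Fin d → ℝ) → ℝ≥0∞) (u : (Fin d → ℝ) → ℝ≥0∞)
    (hσ : ∀ j, Measurable (σ j)) (hσ0 : ∀ j x, σ j x ≠ 0) (hσt : ∀ j x, σ j x ≠ ∞)
    (hu : Measurable u) (hu0 : ∀ x, u x ≠ 0) (hut : ∀ x, u x ≠ ∞)
    (hσQ : ∀ j (Q : Cube d), ∫⁻ y in Q.set, σ j y ≠ ∞)
    (huQ : ∀ (Q : Cube d), ∫⁻ y in Q.set, u y ≠ ∞) (a : ℝ≥0∞)
    (hA : ∀ Q : Cube d, (∏ j, (∫⁻ y in Q.set, σ j y) ^ c j) * (∫⁻ y in Q.set, u y) ^ B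
      ≤ a * Q.vol ^ (∑ j, i j))
    (G : Fin m → (Fin d → ℝ) → ℝ≥0∞) (hG : ∀ j, Measurable (G j))
    (h : (Fin d → ℝ) → ℝ≥0∞)
    (hh : h = fun x => (∏ j, (σ j x ^ (- β j) * MD (σ j) (G j) x ^ i j)) ^ (1 / (γ * B)))
    (Q : Cube d) (x : Fin d → ℝ) (hx : x ∈ Q.set) :
    ∏ j, ((∫⁻ y in Q.set, G j y) / Q.vol) ^ i j ≤
      ((5 : ℝ≥0∞) ^ d) ^ (γ * ∑ j, i j) * a ^ γ * MD u h x ^ (γ * B) := by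
  set κ := γ * B with hκ
  have hκ0 : 0 < κ := by positivity
  have hβs : 0 ≤ ∑ j, β j := Finset.sum_nonneg fun j _ => hβ j
  set S := κ + ∑ j, β j with hS
  have hS0 : 0 < S := by positivity
  set N := ∑ j, i j with hNdef
  have hSN : S + N = γ * N := by
    have : ∑ j, β j = γ * ∑ j, c j - N := by
      simp_rw [hcβ, Finset.sum_sub_distrib, Finset.mul_sum]; rfl
    rw [hS, this, hκ, ← hN]; ring
  have hT : ∀ j, Measurable (MD (σ j) (G j)) := fun j => measurable_MD (hσ j) (hG j)
  have hhm : Measurable h := by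
    rw [hh]
    refine Measurable.pow_const ?_ _
    exact Finset.measurable_fun_prod _ fun j _ => ((hσ j).pow_const _).mul ((hT j).pow_const _)
  set V := Q.vol with hV
  have hV0 : V ≠ 0 := Q.vol_ne_zero_s3
  have hVt : V ≠ ∞ := Q.vol_ne_top_s3
  set s : Fin m → ℝ≥0∞ := fun j => ∫⁻ y in Q.five.set, σ j y with hs
  have hs0 : ∀ j, s j ≠ 0 := fun j => lint_pos (hσ j) (hσ0 j) _
  have hst : ∀ j, s j ≠ ∞ := fun j => hσQ j _
  set U := ∫⁻ y in Q.five.set, u y with hU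
  have hU0 : U ≠ 0 := lint_pos hu hu0 _
  have hUt : U ≠ ∞ := huQ _
  set I : Fin m → ℝ≥0∞ := fun j => ∫⁻ y in Q.set, G j y with hI
  set X := ∏ j, (I j / s j) ^ i j with hX
  set Y := (∫⁻ y in Q.set, h y) ^ κ with hY
  set Pb := ∏ j, s j ^ β j with hPb
  set Ps := ∏ j, s j ^ (γ * c j) with hPs
  set P1 := ∏ j, s j ^ i j with hP1
  have hPP : P1 * Pb = Ps := by
    rw [hP1, hPb, hPs, ← Finset.prod_mul_distrib]
    refine Finset.prod_congr rfl fun j _ => ?_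
    rw [← ENNReal.rpow_add _ _ (hs0 j) (hst j), hcβ]; congr 1; ring
  have hPb0 : Pb ≠ 0 := Finset.prod_ne_zero_iff.2 fun j _ => by
    simp [ENNReal.rpow_eq_zero_iff, hs0 j, hst j]
  have hPbt : Pb ≠ ∞ := ENNReal.prod_ne_top fun j _ => by
    simp [ENNReal.rpow_eq_top_iff, hs0 j, hst j]
  -- Hölder
  have H : X * V ^ S ≤ Y * Pb := by
    have hpt : ∀ y, h y ^ (κ / S) * ∏ j, σ j y ^ (β j / S)
        = (∏ j, MD (σ j) (G j) y ^ i j) ^ (1 / S) := by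
      intro y
      rw [hh]
      simp only
      rw [← ENNReal.rpow_mul]
      have e1 : 1 / κ * (κ / S) = 1 / S := by field_simp
      rw [e1]
      have e2 : ∏ j, σ j y ^ (β j / S) = (∏ j, σ j y ^ β j) ^ (1 / S) := by
        rw [← ENNReal.prod_rpow_of_nonneg (by positivity)]
        refine Finset.prod_congr rfl fun j _ => ?_
        rw [← ENNReal.rpow_mul]; congr 1; ring
      rw [e2, ← ENNReal.mul_rpow_of_nonneg _ _ (by positivity), ← Finset.prod_mul_distrib]
      congr 1
      refine Finset.prod_congr rfl fun j _ => ?_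
      rw [mul_right_comm, ← ENNReal.rpow_add _ _ (hσ0 j y) (hσt j y)]
      simp
    have h1 : X ^ (1 / S) * V ≤ (∫⁻ y in Q.set, h y) ^ (κ / S) *
        ∏ j, (∫⁻ y in Q.set, σ j y) ^ (β j / S) := by
      calc X ^ (1 / S) * V = ∫⁻ y in Q.set, X ^ (1 / S) := by simp [hV, Cube.vol]
        _ ≤ ∫⁻ y in Q.set, h y ^ (κ / S) * ∏ j, σ j y ^ (β j / S) := by
            refine setLIntegral_mono' Q.measurableSet fun y hy => ?_
            rw [hpt]
            refine ENNReal.rpow_le_rpow ?_ (by positivity)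
            refine Finset.prod_le_prod' fun j _ => ENNReal.rpow_le_rpow ?_ (hi j)
            exact MD_ge (hσ j) (hG j) (hσ0 j) (hσt j) Q hy
        _ ≤ _ := by
            refine ENNReal.lintegral_mul_prod_norm_pow_le _ hhm.aemeasurable
              (fun j _ => (hσ j).aemeasurable) _ ?_ (by positivity)
              (fun j _ => div_nonneg (hβ j) hS0.le)
            rw [← Finset.sum_div, ← add_div, ← hS, div_self hS0.ne']
    have h2 := ENNReal.rpow_le_rpow h1 hS0.le
    rw [ENNReal.mul_rpow_of_nonneg _ _ hS0.le, ← ENNReal.rpow_mul, one_div,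
      inv_mul_cancel₀ hS0.ne', ENNReal.rpow_one, ENNReal.mul_rpow_of_nonneg _ _ hS0.le,
      ← ENNReal.rpow_mul, div_mul_cancel₀ _ hS0.ne', ← ENNReal.prod_rpow_of_nonneg hS0.le] at h2
    refine h2.trans ?_
    refine mul_le_mul' le_rfl (Finset.prod_le_prod' fun j _ => ?_)
    rw [← ENNReal.rpow_mul, div_mul_cancel₀ _ hS0.ne']
    exact ENNReal.rpow_le_rpow (lintegral_mono_set Q.sub_five) (hβ j)
  have hAa : Ps * U ^ κ ≤ a ^ γ * (((5 : ℝ≥0∞) ^ d) ^ (γ * N) * V ^ (γ * N)) := by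
    have h1 := ENNReal.rpow_le_rpow (hA Q.five) hγ.le
    rw [ENNReal.mul_rpow_of_nonneg _ _ hγ.le, ENNReal.mul_rpow_of_nonneg _ _ hγ.le,
      ← ENNReal.prod_rpow_of_nonneg hγ.le, ← ENNReal.rpow_mul, ← ENNReal.rpow_mul,
      mul_comm B, mul_comm (∑ j, i j), Cube.vol_five,
      ENNReal.mul_rpow_of_ne_top (by finiteness) hVt] at h1
    refine le_trans (le_of_eq ?_) h1
    rw [hPs]
    congr 1
    refine Finset.prod_congr rfl fun j _ => ?_
    rw [← ENNReal.rpow_mul, mul_comm γ]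
  have hUk0 : U ^ κ ≠ 0 := by simp [ENNReal.rpow_eq_zero_iff, hU0, hUt]
  have hUkt : U ^ κ ≠ ∞ := by simp [ENNReal.rpow_eq_top_iff, hU0, hUt]
  have hVS0 : V ^ S ≠ 0 := by simp [ENNReal.rpow_eq_zero_iff, hV0, hVt]
  have hVSt : V ^ S ≠ ∞ := by simp [ENNReal.rpow_eq_top_iff, hV0, hVt]
  have hVN0 : V ^ N ≠ 0 := by simp [ENNReal.rpow_eq_zero_iff, hV0, hVt]
  have hVNt : V ^ N ≠ ∞ := by simp [ENNReal.rpow_eq_top_iff, hV0, hVt]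
  have main : X * P1 * U ^ κ ≤ ((5 : ℝ≥0∞) ^ d) ^ (γ * N) * a ^ γ * Y * V ^ N := by
    rw [← ENNReal.mul_le_mul_iff_left hVS0 hVSt, ← ENNReal.mul_le_mul_iff_left hPb0 hPbt]
    calc X * P1 * U ^ κ * V ^ S * Pb = (X * V ^ S) * (P1 * Pb * U ^ κ) := by ring
      _ ≤ (Y * Pb) * (a ^ γ * (((5 : ℝ≥0∞) ^ d) ^ (γ * N) * V ^ (γ * N))) := by
          rw [hPP]; exact mul_le_mul' H hAa
      _ = _ := by
          rw [← hSN, ENNReal.rpow_add _ _ hV0 hVt]; ring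
  have hlhs : ∏ j, (I j / V) ^ i j = X * P1 / V ^ N := by
    rw [hX, hP1, ← Finset.prod_mul_distrib, hNdef, ← rpow_sum_aux _ _ hV0 hVt, div_eq_mul_inv,
      ENNReal.prod_inv_distrib, ← Finset.prod_mul_distrib]
    · refine Finset.prod_congr rfl fun j _ => ?_
      rw [← ENNReal.mul_rpow_of_nonneg _ _ (hi j), ENNReal.div_mul_cancel (hs0 j) (hst j),
        ENNReal.div_rpow_of_nonneg _ _ (hi j), div_eq_mul_inv]
    · intro j _ k _ _
      left
      simp [ENNReal.rpow_eq_zero_iff, hV0, hVt]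
  rw [hlhs]
  refine ENNReal.div_le_of_le_mul ?_
  have hMD : Y / U ^ κ ≤ MD u h x ^ κ := by
    rw [hY, ← ENNReal.div_rpow_of_nonneg _ _ hκ0.le]
    exact ENNReal.rpow_le_rpow (MD_ge hu hhm hu0 hut Q hx) hκ0.le
  calc X * P1 ≤ ((5 : ℝ≥0∞) ^ d) ^ (γ * N) * a ^ γ * Y * V ^ N / U ^ κ := by
        rwa [ENNReal.le_div_iff_mul_le (Or.inl hUk0) (Or.inl hUkt)]
    _ = ((5 : ℝ≥0∞) ^ d) ^ (γ * N) * a ^ γ * (Y / U ^ κ) * V ^ N := by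
        rw [div_eq_mul_inv, div_eq_mul_inv]; ring
    _ ≤ _ := by gcongr

theorem MC_le_of_ae {d : ℕ} {μ : Measure (Fin d → ℝ)} {g : (Fin d → ℝ) → ℝ≥0∞} {k : ℝ≥0∞}
    (h : ∀ᵐ x ∂μ, g x ≤ k) (x : Fin d → ℝ) : MC μ g x ≤ k := by
  refine iSup_le fun ρ => ENNReal.div_le_of_le_mul ?_
  calc _ ≤ ∫⁻ y in Metric.closedBall x ((ρ : ℚ) : ℝ), k ∂μ :=
        lintegral_mono_ae (ae_restrict_of_ae h)
    _ = _ := by simp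

theorem single_bound (d : ℕ) (r p : ℝ≥0∞) (hr0 : 0 < r) (hrt : r ≠ ∞) (hrp : r < p) :
    ∃ K : ℝ≥0∞, K ≠ ∞ ∧ ∀ (w : (Fin d → ℝ) → ℝ), Measurable w → (∀ x, 0 < w x) →
      ∀ (f : (Fin d → ℝ) → ℂ), Measurable f →
      ∃ (k : ℝ≥0∞) (F : (Fin d → ℝ) → ℝ≥0∞), Measurable F ∧
        (∀ x, MD (fun x => ENNReal.ofReal (w x)⁻¹ ^ (1 / (r⁻¹ - p⁻¹).toReal))
            (fun x => nn f x ^ r.toReal) x ^ (1 / r.toReal) *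
            (ENNReal.ofReal (w x)⁻¹ ^ (1 / (r⁻¹ - p⁻¹).toReal)) ^ (p⁻¹).toReal
            ≤ k * F x ^ (p⁻¹).toReal) ∧
        k * (∫⁻ x, F x) ^ (p⁻¹).toReal ≤ K * wNorm p w (nn f) := by
  set R := r.toReal with hR
  have hR0 : 0 < R := ENNReal.toReal_pos hr0.ne' hrt
  rcases eq_or_ne p ∞ with rfl | hp
  · refine ⟨1, by simp, fun w hw hw0 f hf => ⟨wNorm ∞ w (nn f), fun _ => 1, measurable_const,
      fun x => ?_, by simp⟩⟩
    simp only [ENNReal.inv_top, tsub_zero, ENNReal.toReal_zero, ENNReal.rpow_zero, mul_one,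
      ENNReal.toReal_inv, one_div, inv_inv]
    rw [← hR]
    set k := wNorm ∞ w (nn f) with hk
    have hae : ∀ᵐ x, nn f x * ENNReal.ofReal (w x) ≤ k := by
      rw [hk, wNorm, eNorm, if_pos rfl]
      exact ENNReal.ae_le_essSup _
    have h1 : MD (fun x => ENNReal.ofReal (w x)⁻¹ ^ R) (fun x => nn f x ^ R) x ≤ k ^ R := by
      refine MC_le_of_ae ?_ x
      refine (withDensity_absolutelyContinuous volume _).ae_le ?_
      filter_upwards [hae] with y hy
      rw [← ENNReal.div_rpow_of_nonneg _ _ hR0.le]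
      refine ENNReal.rpow_le_rpow ?_ hR0.le
      rwa [ENNReal.ofReal_inv_of_pos (hw0 y), div_eq_mul_inv, inv_inv]
    calc _ ≤ (k ^ R) ^ R⁻¹ := ENNReal.rpow_le_rpow h1 (by positivity)
      _ = k := by rw [← ENNReal.rpow_mul, mul_inv_cancel₀ hR0.ne', ENNReal.rpow_one]
  · set P := p.toReal with hP
    have hp0 : p ≠ 0 := (hr0.trans hrp).ne'
    have hP0 : 0 < P := ENNReal.toReal_pos hp0 hp
    have hRP : R < P := (ENNReal.toReal_lt_toReal hrt hp).2 hrp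
    have hq : 1 < P / R := (one_lt_div hR0).2 hRP
    obtain ⟨C, hC, h⟩ := MD_strong d (P / R) hq
    have hc : (r⁻¹ - p⁻¹).toReal = 1 / R - 1 / P := by
      rw [ENNReal.toReal_sub_of_le (ENNReal.inv_le_inv.2 hrp.le) (by simpa using hr0.ne'),
        ENNReal.toReal_inv, ENNReal.toReal_inv, one_div, one_div]
    have hb : (p⁻¹).toReal = 1 / P := by rw [ENNReal.toReal_inv, one_div]
    rw [hc, hb]
    set c := 1 / R - 1 / P with hcdef
    have hc0 : 0 < c := sub_pos.2 (one_div_lt_one_div_of_lt hR0 hRP)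
    refine ⟨C ^ (1 / P), by finiteness, fun w hw hw0 f hf => ?_⟩
    set σ : (Fin d → ℝ) → ℝ≥0∞ := fun x => ENNReal.ofReal (w x)⁻¹ ^ (1 / c) with hσ
    set G : (Fin d → ℝ) → ℝ≥0∞ := fun x => nn f x ^ R with hG
    have hσm : Measurable σ := (hw.inv.ennreal_ofReal).pow_const _
    have hnn : Measurable (nn f) := hf.nnnorm.coe_nnreal_ennreal
    have hGm : Measurable G := hnn.pow_const _
    refine ⟨1, fun x => MD σ G x ^ (P / R) * σ x, ((measurable_MD hσm hGm).pow_const _).mul hσm,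
      fun x => ?_, ?_⟩
    · rw [one_mul, ENNReal.mul_rpow_of_nonneg _ _ (by positivity), ← ENNReal.rpow_mul (MD σ G x)]
      have : P / R * (1 / P) = 1 / R := by field_simp
      rw [this]
    · rw [one_mul, wNorm, eNorm, if_neg hp, ← ENNReal.mul_rpow_of_nonneg _ _ (by positivity)]
      refine ENNReal.rpow_le_rpow ((h σ G hσm hGm).trans (le_of_eq ?_)) (by positivity)
      congr 1
      refine lintegral_congr fun x => ?_
      have hW0 : ENNReal.ofReal (w x) ≠ 0 := by simpa using hw0 x
      have hWt : ENNReal.ofReal (w x) ≠ ∞ := by simp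
      set W := ENNReal.ofReal (w x) with hW
      have hσx : σ x = W ^ (-(1 / c)) := by
        rw [hσ]; simp only
        rw [ENNReal.ofReal_inv_of_pos (hw0 x), ENNReal.inv_rpow, ENNReal.rpow_neg]
      have hinv : (W ^ (-(1 / c)))⁻¹ = W ^ (1 / c) := by rw [ENNReal.rpow_neg, inv_inv]
      rw [hσx, div_eq_mul_inv, hinv, ENNReal.mul_rpow_of_nonneg _ _ (by positivity), hG]
      simp only
      rw [← ENNReal.rpow_mul, ← ENNReal.rpow_mul, mul_assoc, ← ENNReal.rpow_add _ _ hW0 hWt,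
        ENNReal.mul_rpow_of_nonneg _ _ hP0.le]
      have e1 : R * (P / R) = P := by field_simp
      have e2 : 1 / c * (P / R) + -(1 / c) = P := by
        have : P / R - 1 = P * c := by rw [hcdef]; field_simp
        calc _ = (P / R - 1) / c := by ring
          _ = P := by rw [this]; field_simp
      rw [e1, e2]

theorem prod_factor_ne_top {ι : Type*} {s : Finset ι} {x : ι → ℝ≥0∞} (h0 : ∀ j ∈ s, x j ≠ 0)
    (h : ∏ j ∈ s, x j ≠ ∞) : ∀ j ∈ s, x j ≠ ∞ := by
  classical
  intro j hj hjt
  rw [← Finset.mul_prod_erase s x hj, hjt, ENNReal.top_mul] at h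
  · exact h rfl
  · exact Finset.prod_ne_zero_iff.2 fun k hk => h0 k (Finset.mem_of_mem_erase hk)

theorem core_bound (d m : ℕ) (γ : ℝ) (hγ : 1 < γ) : ∃ C2 : ℝ≥0∞, C2 ≠ ∞ ∧
    ∀ (c i b β : Fin m → ℝ) (B P : ℝ) (_ : 0 < B) (_ : P = 1 / B)
    (_ : ∀ j, 0 ≤ i j) (_ : ∀ j, 0 < c j) (_ : ∀ j, 0 ≤ b j) (_ : ∑ j, b j = B)
    (_ : ∀ j, i j = c j + b j)
    (_ : ∀ j, 0 ≤ β j) (_ : ∀ j, β j = γ * c j - i j)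
    (σ : Fin m → (Fin d → ℝ) → ℝ≥0∞) (u : (Fin d → ℝ) → ℝ≥0∞)
    (_ : ∀ j, Measurable (σ j)) (_ : ∀ j x, σ j x ≠ 0) (_ : ∀ j x, σ j x ≠ ∞)
    (_ : ∀ x, u x = ∏ j, σ j x ^ (-(P * c j)))
    (a : ℝ≥0∞) (_ : a ≠ ∞)
    (_ : ∀ Q : Cube d, (∏ j, (∫⁻ y in Q.set, σ j y) ^ c j) * (∫⁻ y in Q.set, u y) ^ B
      ≤ a * Q.vol ^ (∑ j, i j))
    (G : Fin m → (Fin d → ℝ) → ℝ≥0∞) (_ : ∀ j, Measurable (G j))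
    (k : Fin m → ℝ≥0∞) (F : Fin m → (Fin d → ℝ) → ℝ≥0∞) (_ : ∀ j, Measurable (F j))
    (_ : ∀ j x, MD (σ j) (G j) x ^ i j * σ j x ^ b j ≤ k j * F j x ^ b j)
    (Mf : (Fin d → ℝ) → ℝ≥0∞)
    (_ : ∀ x, Mf x ≤ ⨆ (Q : Cube d) (_ : x ∈ Q.set),
      ∏ j, ((∫⁻ y in Q.set, G j y) / Q.vol) ^ i j),
    ∫⁻ x, Mf x ^ P * u x ≤ (((5 : ℝ≥0∞) ^ d) ^ (γ * ∑ j, i j) * a ^ γ) ^ P * (C2 *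
      (∏ j, k j * (∫⁻ x, F j x) ^ b j) ^ P) := by
  obtain ⟨C2, hC2, hmax⟩ := MD_strong d γ hγ
  refine ⟨C2, hC2, ?_⟩
  intro c i b β B P hB hPB hi hc hb hbB hicb hβ hβdef σ u hσ hσ0 hσt hudef a ha hA G hG k F hF hkF
    Mf hMf
  have hP : 0 < P := by rw [hPB]; positivity
  have hγ0 : 0 < γ := by linarith
  have hum : Measurable u := by
    rw [show u = fun x => ∏ j, σ j x ^ (-(P * c j)) from funext hudef]
    exact Finset.measurable_fun_prod _ fun j _ => (hσ j).pow_const _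
  have hpt : ∀ j x (e : ℝ), σ j x ^ e ≠ ∞ := fun j x e => by
    simp [ENNReal.rpow_eq_top_iff, hσ0 j x, hσt j x]
  have hp0 : ∀ j x (e : ℝ), σ j x ^ e ≠ 0 := fun j x e => by
    simp [ENNReal.rpow_eq_zero_iff, hσ0 j x, hσt j x]
  have hu0 : ∀ x, u x ≠ 0 := fun x => by
    rw [hudef]; exact Finset.prod_ne_zero_iff.2 fun j _ => hp0 j x _
  have hut : ∀ x, u x ≠ ∞ := fun x => by
    rw [hudef]; exact ENNReal.prod_ne_top fun j _ => hpt j x _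
  have hN : ∑ j, c j + B = ∑ j, i j := by
    rw [← hbB, ← Finset.sum_add_distrib]; exact Finset.sum_congr rfl fun j _ => (hicb j).symm
  have hN0 : 0 ≤ ∑ j, i j := Finset.sum_nonneg fun j _ => hi j
  have hfin : ∀ Q : Cube d, (∏ j, (∫⁻ y in Q.set, σ j y) ^ c j) ≠ ∞ ∧
      (∫⁻ y in Q.set, u y) ^ B ≠ ∞ := by
    intro Q
    have h1 : (∏ j, (∫⁻ y in Q.set, σ j y) ^ c j) * (∫⁻ y in Q.set, u y) ^ B ≠ ∞ := by
      refine ne_top_of_le_ne_top ?_ (hA Q)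
      exact ENNReal.mul_ne_top ha (ENNReal.rpow_ne_top_of_nonneg hN0 Q.vol_ne_top_s3)
    have h2 : (∏ j, (∫⁻ y in Q.set, σ j y) ^ c j) ≠ 0 := Finset.prod_ne_zero_iff.2 fun j _ => by
      have := lint_pos (hσ j) (hσ0 j) Q
      simp [ENNReal.rpow_eq_zero_iff, this, (hc j).le]
    have h3 : (∫⁻ y in Q.set, u y) ^ B ≠ 0 := by
      have := lint_pos hum hu0 Q
      simp [ENNReal.rpow_eq_zero_iff, this, hB.le]
    constructor
    · intro h; rw [h, ENNReal.top_mul h3] at h1; exact h1 rfl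
    · intro h; rw [h, ENNReal.mul_top h2] at h1; exact h1 rfl
  have hσQ : ∀ j (Q : Cube d), ∫⁻ y in Q.set, σ j y ≠ ∞ := by
    intro j Q h
    refine prod_factor_ne_top (fun j _ => ?_) (hfin Q).1 j (Finset.mem_univ j) ?_
    · have := lint_pos (hσ j) (hσ0 j) Q
      simp [ENNReal.rpow_eq_zero_iff, this, (hc j).le]
    · rw [h, ENNReal.top_rpow_of_pos (hc j)]
  have huQ : ∀ (Q : Cube d), ∫⁻ y in Q.set, u y ≠ ∞ := by
    intro Q h
    apply (hfin Q).2
    rw [h, ENNReal.top_rpow_of_pos hB]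
  set h : (Fin d → ℝ) → ℝ≥0∞ :=
    fun x => (∏ j, (σ j x ^ (- β j) * MD (σ j) (G j) x ^ i j)) ^ (1 / (γ * B)) with hh
  have hT : ∀ j, Measurable (MD (σ j) (G j)) := fun j => measurable_MD (hσ j) (hG j)
  have hhm : Measurable h := by
    refine Measurable.pow_const ?_ _
    exact Finset.measurable_fun_prod _ fun j _ => ((hσ j).pow_const _).mul ((hT j).pow_const _)
  set C1 := ((5 : ℝ≥0∞) ^ d) ^ (γ * ∑ j, i j) * a ^ γ with hC1
  have hC1t : C1 ≠ ∞ := by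
    refine ENNReal.mul_ne_top ?_ ?_
    · exact ENNReal.rpow_ne_top_of_nonneg (by positivity) (by finiteness)
    · exact ENNReal.rpow_ne_top_of_nonneg hγ0.le ha
  have hptw : ∀ x, Mf x ≤ C1 * MD u h x ^ (γ * B) := by
    intro x
    refine (hMf x).trans (iSup₂_le fun Q hx => ?_)
    exact pointwise_step c i β B γ hB hγ0 hi hβ hβdef hN σ u hσ hσ0 hσt hum hu0 hut hσQ huQ a hA
      G hG h hh Q x hx
  have hid : ∀ x, (h x / u x) ^ γ * u x = ∏ j, (MD (σ j) (G j) x ^ i j * σ j x ^ b j) ^ P := by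
    intro x
    have e0 : h x ^ γ = ∏ j, (σ j x ^ (-(P * β j)) * (MD (σ j) (G j) x ^ i j) ^ P) := by
      rw [hh]; simp only
      rw [← ENNReal.rpow_mul]
      have : 1 / (γ * B) * γ = P := by rw [hPB]; field_simp
      rw [this, ← ENNReal.prod_rpow_of_nonneg hP.le]
      refine Finset.prod_congr rfl fun j _ => ?_
      rw [ENNReal.mul_rpow_of_nonneg _ _ hP.le, ← ENNReal.rpow_mul]
      congr 2; ring
    have e1 : (h x / u x) ^ γ * u x = h x ^ γ * u x ^ (1 - γ) := by
      rw [ENNReal.div_rpow_of_nonneg _ _ hγ0.le, div_eq_mul_inv, ← ENNReal.rpow_neg, mul_assoc]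
      congr 1
      rw [sub_eq_neg_add, ENNReal.rpow_add _ _ (hu0 x) (hut x), ENNReal.rpow_one]
    rw [e1, e0, hudef, ← ENNReal.prod_rpow_of_ne_top (fun j _ => hpt j x _),
      ← Finset.prod_mul_distrib]
    refine Finset.prod_congr rfl fun j _ => ?_
    rw [mul_right_comm, ← ENNReal.rpow_mul, ← ENNReal.rpow_add _ _ (hσ0 j x) (hσt j x),
      ENNReal.mul_rpow_of_nonneg _ _ hP.le, mul_comm, ← ENNReal.rpow_mul (σ j x)]
    congr 2
    rw [hβdef, hicb]; ring
  calc ∫⁻ x, Mf x ^ P * u x ≤ ∫⁻ x, C1 ^ P * (MD u h x ^ γ * u x) := by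
        refine lintegral_mono fun x => ?_
        calc Mf x ^ P * u x ≤ (C1 * MD u h x ^ (γ * B)) ^ P * u x := by
              gcongr; exact hptw x
          _ = _ := by
              rw [ENNReal.mul_rpow_of_nonneg _ _ hP.le, ← ENNReal.rpow_mul, mul_assoc]
              congr 4
              rw [hPB]; field_simp
    _ = C1 ^ P * ∫⁻ x, MD u h x ^ γ * u x :=
        lintegral_const_mul' _ _ (ENNReal.rpow_ne_top_of_nonneg hP.le hC1t)
    _ ≤ C1 ^ P * (C2 * ∫⁻ x, (h x / u x) ^ γ * u x) := by
        gcongr; exact hmax u h hum hhm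
    _ ≤ C1 ^ P * (C2 * (∏ j, k j * (∫⁻ x, F j x) ^ b j) ^ P) := by
        refine mul_le_mul' le_rfl (mul_le_mul' le_rfl ?_)
        calc ∫⁻ x, (h x / u x) ^ γ * u x
            ≤ ∫⁻ x, (∏ j, k j ^ P) * ∏ j, F j x ^ (b j * P) := by
              refine lintegral_mono fun x => ?_
              simp only
              rw [hid, ← Finset.prod_mul_distrib]
              refine Finset.prod_le_prod' fun j _ => ?_
              rw [ENNReal.rpow_mul, ← ENNReal.mul_rpow_of_nonneg _ _ hP.le]
              exact ENNReal.rpow_le_rpow (hkF j x) hP.le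
          _ = (∏ j, k j ^ P) * ∫⁻ x, ∏ j, F j x ^ (b j * P) :=
              lintegral_const_mul _ (Finset.measurable_fun_prod _ fun j _ => (hF j).pow_const _)
          _ ≤ (∏ j, k j ^ P) * ∏ j, (∫⁻ x, F j x) ^ (b j * P) := by
              refine mul_le_mul' le_rfl (ENNReal.lintegral_prod_norm_pow_le _
                (fun j _ => (hF j).aemeasurable) ?_ (fun j _ => mul_nonneg (hb j) hP.le))
              rw [← Finset.sum_mul, hbB, hPB]; field_simp
          _ = _ := by
              rw [← Finset.prod_mul_distrib, ← ENNReal.prod_rpow_of_nonneg hP.le]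
              refine Finset.prod_congr rfl fun j _ => ?_
              rw [ENNReal.mul_rpow_of_nonneg _ _ hP.le, ENNReal.rpow_mul]

theorem exists_rat_cube {d : ℕ} (Q : Cube d) : ∃ (n : Fin d → ℚ) (l : {q : ℚ // 0 < q}),
    ∀ Q' : Cube d, Q'.corner = (fun i => (n i : ℝ)) → Q'.side = ((l : ℚ) : ℝ) →
      Q.set ⊆ Q'.set ∧ Q'.vol ≤ 5 ^ d * Q.vol := by
  have hs := Q.side_pos
  have h1 : ∀ i, ∃ q : ℚ, Q.corner i - Q.side < q ∧ (q : ℝ) < Q.corner i := fun i =>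
    exists_rat_btwn (by linarith)
  choose n hn1 hn2 using h1
  obtain ⟨l, hl1, hl2⟩ := exists_rat_btwn (show 2 * Q.side < 3 * Q.side by linarith)
  have hl : (0:ℝ) < l := by linarith
  refine ⟨n, ⟨l, by exact_mod_cast hl⟩, fun Q' hc hl' => ⟨fun x hx i => ?_, ?_⟩⟩
  · rw [hc, hl']
    have := hx i
    simp only
    constructor <;> linarith [hx i, hn1 i, hn2 i]
  · rw [Cube.vol_eq_s3, Cube.vol_eq_s3, ← mul_pow]
    refine pow_le_pow_left₀ (by simp) ?_ _
    rw [hl', show (5 : ℝ≥0∞) = ENNReal.ofReal 5 by simp, ← ENNReal.ofReal_mul (by norm_num)]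
    apply ENNReal.ofReal_le_ofReal
    simp only
    linarith

theorem infty_bound (d m : ℕ) (r : Fin m → ℝ≥0∞) (hr : ∀ j, 0 < r j ∧ r j ≠ ∞)
    (w : Fin m → (Fin d → ℝ) → ℝ) (hw : ∀ j, Measurable (w j)) (hw0 : ∀ j x, 0 < w j x)
    (a : ℝ≥0∞)
    (ha : ∀ Q : Cube d, (∏ j, avg (r j) (fun x => ENNReal.ofReal (w j x)⁻¹) Q) *
      essSup (fun x => ENNReal.ofReal (∏ j, w j x)) (volume.restrict Q.set) ≤ a)
    (f : Fin m → (Fin d → ℝ) → ℂ) :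
    wNorm ∞ (fun x => ∏ j, w j x) (maximal r (fun j => nn (f j))) ≤
      (∏ j, ((5 : ℝ≥0∞) ^ d) ^ (1 / (r j).toReal)) * a * ∏ j, wNorm ∞ (w j) (nn (f j)) := by
  rw [wNorm, eNorm, if_pos rfl]
  have hcub : ∀ᵐ x : Fin d → ℝ, ∀ z : (Fin d → ℚ) × {q : ℚ // 0 < q}, ∀ Q' : Cube d,
      Q'.corner = (fun i => (z.1 i : ℝ)) → Q'.side = ((z.2 : ℚ) : ℝ) → x ∈ Q'.set →
      ENNReal.ofReal (∏ j, w j x) ≤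
        essSup (fun x => ENNReal.ofReal (∏ j, w j x)) (volume.restrict Q'.set) := by
    rw [ae_all_iff]
    intro z
    let Q0 : Cube d := ⟨fun i => (z.1 i : ℝ), ((z.2 : ℚ) : ℝ), by exact_mod_cast z.2.2⟩
    have h := ENNReal.ae_le_essSup (μ := volume.restrict Q0.set)
      (fun x => ENNReal.ofReal (∏ j, w j x))
    rw [ae_restrict_iff' Q0.measurableSet] at h
    filter_upwards [h] with x hx Q' h1 h2 hx'
    have : Q' = Q0 := by
      cases Q'; simp only at h1 h2; subst h1; subst h2; rfl
    subst this
    exact hx hx'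
  set n : Fin m → ℝ≥0∞ := fun j => wNorm ∞ (w j) (nn (f j)) with hn
  have hf : ∀ j, ∀ᵐ x : Fin d → ℝ, nn (f j) x ≤ n j * ENNReal.ofReal (w j x)⁻¹ := by
    intro j
    have h1 : ∀ᵐ x, nn (f j) x * ENNReal.ofReal (w j x) ≤ n j := by
      simp only [hn, wNorm, eNorm, if_pos rfl]
      exact ENNReal.ae_le_essSup _
    filter_upwards [h1] with x hx
    rw [ENNReal.ofReal_inv_of_pos (hw0 j x), ← div_eq_mul_inv,
      ENNReal.le_div_iff_mul_le (by simp [hw0 j x]) (by simp)]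
    exact hx
  have havg : ∀ j (Q Q' : Cube d), Q.set ⊆ Q'.set → Q'.vol ≤ 5 ^ d * Q.vol →
      avg (r j) (nn (f j)) Q ≤ ((5 : ℝ≥0∞) ^ d) ^ (1 / (r j).toReal) *
        (n j * avg (r j) (fun x => ENNReal.ofReal (w j x)⁻¹) Q') := by
    intro j Q Q' hsub hvol
    simp only [avg, if_neg (hr j).2]
    set R := (r j).toReal
    have hR : 0 < R := ENNReal.toReal_pos (hr j).1.ne' (hr j).2
    have e : n j = (n j ^ R) ^ (1 / R) := by
      rw [← ENNReal.rpow_mul, mul_one_div_cancel hR.ne', ENNReal.rpow_one]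
    rw [e, ← ENNReal.mul_rpow_of_nonneg _ _ (by positivity),
      ← ENNReal.mul_rpow_of_nonneg _ _ (by positivity)]
    refine ENNReal.rpow_le_rpow ?_ (by positivity)
    refine ENNReal.div_le_of_le_mul ?_
    have h1 : ∫⁻ x in Q.set, nn (f j) x ^ R ≤
        n j ^ R * ∫⁻ x in Q'.set, ENNReal.ofReal (w j x)⁻¹ ^ R := by
      have hwm : Measurable fun x => ENNReal.ofReal (w j x)⁻¹ ^ R :=
        ((hw j).inv.ennreal_ofReal).pow_const _
      rw [← lintegral_const_mul _ hwm]
      refine (lintegral_mono_set hsub).trans (lintegral_mono_ae (ae_restrict_of_ae ?_))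
      filter_upwards [hf j] with x hx
      rw [← ENNReal.mul_rpow_of_nonneg _ _ hR.le]
      exact ENNReal.rpow_le_rpow hx hR.le
    refine h1.trans ?_
    set I := ∫⁻ x in Q'.set, ENNReal.ofReal (w j x)⁻¹ ^ R
    calc n j ^ R * I = n j ^ R * (I / Q'.vol * Q'.vol) := by
          rw [ENNReal.div_mul_cancel Q'.vol_ne_zero_s3 Q'.vol_ne_top_s3]
      _ ≤ n j ^ R * (I / Q'.vol * (5 ^ d * Q.vol)) := by gcongr
      _ = _ := by ring
  refine essSup_le_of_ae_le _ ?_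
  filter_upwards [hcub] with x hx
  rw [maximal, ENNReal.iSup_mul]
  refine iSup_le fun Q => ?_
  rw [ENNReal.iSup_mul]
  refine iSup_le fun hxQ => ?_
  obtain ⟨nn', l, hQ⟩ := exists_rat_cube Q
  let Q' : Cube d := ⟨fun i => (nn' i : ℝ), ((l : ℚ) : ℝ), by exact_mod_cast l.2⟩
  obtain ⟨hsub, hvol⟩ := hQ Q' rfl rfl
  calc (∏ j, avg (r j) (nn (f j)) Q) * ENNReal.ofReal (∏ j, w j x)
      ≤ (∏ j, ((5 : ℝ≥0∞) ^ d) ^ (1 / (r j).toReal) *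
        (n j * avg (r j) (fun x => ENNReal.ofReal (w j x)⁻¹) Q')) *
        essSup (fun x => ENNReal.ofReal (∏ j, w j x)) (volume.restrict Q'.set) :=
        mul_le_mul' (Finset.prod_le_prod' fun j _ => havg j Q Q' hsub hvol)
          (hx (nn', l) Q' rfl rfl (hsub hxQ))
    _ = (∏ j, ((5 : ℝ≥0∞) ^ d) ^ (1 / (r j).toReal)) *
        ((∏ j, avg (r j) (fun x => ENNReal.ofReal (w j x)⁻¹) Q') *
        essSup (fun x => ENNReal.ofReal (∏ j, w j x)) (volume.restrict Q'.set)) * ∏ j, n j := by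
        rw [Finset.prod_mul_distrib, Finset.prod_mul_distrib]; ring
    _ ≤ _ := by gcongr; exact ha Q'

/-- sharp weighted bounds for the multisublinear Hardy–Littlewood
maximal operator with multilinear Muckenhoupt weights. -/
theorem statement3 (d m : ℕ) (hd : 1 ≤ d) (hm : 1 ≤ m)
    (r p : Fin m → ℝ≥0∞) (hr : ∀ j, 0 < r j ∧ r j ≠ ∞) (hrp : ∀ j, r j < p j) :
    ∃ C : ℝ≥0∞, 0 < C ∧ C ≠ ∞ ∧
      ∀ (w : Fin m → (Fin d → ℝ) → ℝ),
        (∀ j, Measurable (w j)) → (∀ j x, 0 < w j x) →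
        aConst p r ∞ w ≠ ∞ →
        ∀ (f : Fin m → (Fin d → ℝ) → ℂ), (∀ j, Measurable (f j)) →
          wNorm (∑ j, (p j)⁻¹)⁻¹ (fun x => ∏ j, w j x) (maximal r (fun j => nn (f j))) ≤
            C * aConst p r ∞ w ^ ((⨆ j, (r j)⁻¹ / ((r j)⁻¹ - (p j)⁻¹)).toReal) *
              ∏ j, wNorm (p j) (w j) (nn (f j)) := by
  suffices H : ∃ C : ℝ≥0∞, C ≠ ∞ ∧
      ∀ (w : Fin m → (Fin d → ℝ) → ℝ),
        (∀ j, Measurable (w j)) → (∀ j x, 0 < w j x) →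
        aConst p r ∞ w ≠ ∞ →
        ∀ (f : Fin m → (Fin d → ℝ) → ℂ), (∀ j, Measurable (f j)) →
          wNorm (∑ j, (p j)⁻¹)⁻¹ (fun x => ∏ j, w j x) (maximal r (fun j => nn (f j))) ≤
            C * aConst p r ∞ w ^ ((⨆ j, (r j)⁻¹ / ((r j)⁻¹ - (p j)⁻¹)).toReal) *
              ∏ j, wNorm (p j) (w j) (nn (f j)) by
    obtain ⟨C, hC, h⟩ := H
    refine ⟨C + 1, by simp, by finiteness, fun w h1 h2 h3 f h4 => (h w h1 h2 h3 f h4).trans ?_⟩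
    gcongr
    exact le_self_add
  have hp0 : ∀ j, p j ≠ 0 := fun j => ((hr j).1.trans (hrp j)).ne'
  have hpinv : ∀ j, (p j)⁻¹ ≠ ∞ := fun j => by simpa using hp0 j
  have hrinv : ∀ j, (r j)⁻¹ ≠ ∞ := fun j => by simpa using (hr j).1.ne'
  have hlt : ∀ j, (p j)⁻¹ < (r j)⁻¹ := fun j => ENNReal.inv_lt_inv.2 (hrp j)
  have hdiff0 : ∀ j, (r j)⁻¹ - (p j)⁻¹ ≠ 0 := fun j => (tsub_pos_of_lt (hlt j)).ne'
  have hdifft : ∀ j, (r j)⁻¹ - (p j)⁻¹ ≠ ∞ := fun j => ENNReal.sub_ne_top (hrinv j)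
  have hsumt : ∑ j, (p j)⁻¹ ≠ ∞ := ENNReal.sum_ne_top.2 fun j _ => hpinv j
  by_cases hB : ∑ j, (p j)⁻¹ = 0
  · have hpt : ∀ j, p j = ∞ := fun j => by
      have := (Finset.sum_eq_zero_iff.1 hB) j (Finset.mem_univ j)
      simpa using this
    have hpf : p = fun _ => ∞ := funext hpt
    subst hpf
    refine ⟨∏ j, ((5 : ℝ≥0∞) ^ d) ^ (1 / (r j).toReal), ?_, fun w hw hw0 ha f hf => ?_⟩
    · exact ENNReal.prod_ne_top fun j _ =>
        ENNReal.rpow_ne_top_of_nonneg (by positivity) (by finiteness)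
    · haveI : Nonempty (Fin m) := ⟨⟨0, hm⟩⟩
      have hexp : (⨆ j, (r j)⁻¹ / ((r j)⁻¹ - (∞ : ℝ≥0∞)⁻¹)).toReal = 1 := by
        have : ∀ j, (r j)⁻¹ / ((r j)⁻¹ - (∞ : ℝ≥0∞)⁻¹) = 1 := fun j => by
          rw [ENNReal.inv_top, tsub_zero]
          exact ENNReal.div_self (by simpa using (hr j).2) (hrinv j)
        simp_rw [this]; simp
      rw [hexp, ENNReal.rpow_one, hB, ENNReal.inv_zero]
      refine infty_bound d m r hr w hw hw0 _ (fun Q => ?_) f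
      refine le_trans (le_of_eq ?_) (le_iSup _ Q)
      simp [avg]
  · set c : Fin m → ℝ := fun j => ((r j)⁻¹ - (p j)⁻¹).toReal with hc
    set i : Fin m → ℝ := fun j => 1 / (r j).toReal with hi
    set b : Fin m → ℝ := fun j => ((p j)⁻¹).toReal with hb
    set B : ℝ := (∑ j, (p j)⁻¹).toReal with hBdef
    set γ : ℝ := (⨆ j, (r j)⁻¹ / ((r j)⁻¹ - (p j)⁻¹)).toReal with hγdef
    set P : ℝ := ((∑ j, (p j)⁻¹)⁻¹).toReal with hPdef
    have hPB : P = 1 / B := by rw [hPdef, ENNReal.toReal_inv, one_div]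
    have hB0 : 0 < B := ENNReal.toReal_pos hB hsumt
    have hP0 : 0 < P := by rw [hPB]; positivity
    have hbB : ∑ j, b j = B := (ENNReal.toReal_sum fun j _ => hpinv j).symm
    have hc0 : ∀ j, 0 < c j := fun j => ENNReal.toReal_pos (hdiff0 j) (hdifft j)
    have hb0 : ∀ j, 0 ≤ b j := fun j => ENNReal.toReal_nonneg
    have hi0 : ∀ j, 0 ≤ i j := fun j => by simp only [hi]; positivity
    have hiinv : ∀ j, i j = ((r j)⁻¹).toReal := fun j => by rw [ENNReal.toReal_inv, ← one_div]
    have hicb : ∀ j, i j = c j + b j := fun j => by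
      simp only [hiinv, hc, hb]
      rw [ENNReal.toReal_sub_of_le (hlt j).le (hrinv j)]; ring
    have hsup : (⨆ j, (r j)⁻¹ / ((r j)⁻¹ - (p j)⁻¹)) ≠ ∞ := by
      have h1 : ∀ j, (r j)⁻¹ / ((r j)⁻¹ - (p j)⁻¹) ≠ ∞ := fun j =>
        ENNReal.div_ne_top (hrinv j) (hdiff0 j)
      have h2 : ∑ j, (r j)⁻¹ / ((r j)⁻¹ - (p j)⁻¹) ≠ ∞ := ENNReal.sum_ne_top.2 fun j _ => h1 j
      refine ne_top_of_le_ne_top h2 (iSup_le fun j => ?_)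
      exact Finset.single_le_sum (f := fun j => (r j)⁻¹ / ((r j)⁻¹ - (p j)⁻¹))
        (fun _ _ => zero_le) (Finset.mem_univ j)
    have hγj : ∀ j, i j / c j ≤ γ := fun j => by
      rw [hiinv, hc, ← ENNReal.toReal_div]
      exact ENNReal.toReal_mono hsup (le_iSup (fun j => (r j)⁻¹ / ((r j)⁻¹ - (p j)⁻¹)) j)
    have hγ : 1 < γ := by
      obtain ⟨j, -, hj⟩ := Finset.exists_ne_zero_of_sum_ne_zero (hbB.trans_ne hB0.ne')
      have hbj : 0 < b j := lt_of_le_of_ne (hb0 j) hj.symm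
      refine lt_of_lt_of_le ?_ (hγj j)
      rw [one_lt_div (hc0 j), hicb]; linarith
    have hγ0 : 0 < γ := by linarith
    obtain ⟨C2, hC2, hcore⟩ := core_bound d m γ hγ
    have hsing := fun j => single_bound d (r j) (p j) (hr j).1 (hr j).2 (hrp j)
    choose K hK hsing using hsing
    have hN0 : 0 ≤ ∑ j, i j := Finset.sum_nonneg fun j _ => hi0 j
    refine ⟨((5 : ℝ≥0∞) ^ d) ^ (γ * ∑ j, i j) * C2 ^ (1 / P) * ∏ j, K j, ?_,
      fun w hw hw0 ha f hf => ?_⟩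
    · refine ENNReal.mul_ne_top (ENNReal.mul_ne_top ?_ ?_) (ENNReal.prod_ne_top fun j _ => hK j)
      · exact ENNReal.rpow_ne_top_of_nonneg (by positivity) (by finiteness)
      · exact ENNReal.rpow_ne_top_of_nonneg (by positivity) hC2
    have hsing' := fun j => hsing j (w j) (hw j) (hw0 j) (f j) (hf j)
    choose k F hF hkF hkn using hsing'
    set a := aConst p r ∞ w with hadef
    set σ : Fin m → (Fin d → ℝ) → ℝ≥0∞ := fun j x => ENNReal.ofReal (w j x)⁻¹ ^ (1 / c j) with hσ
    set u : (Fin d → ℝ) → ℝ≥0∞ := fun x => ENNReal.ofReal (∏ j, w j x) ^ P with hu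
    have hW0 : ∀ j x, ENNReal.ofReal (w j x)⁻¹ ≠ 0 := fun j x => by simpa using hw0 j x
    have hpne : (∑ j, (p j)⁻¹)⁻¹ ≠ ∞ := by simpa using hB
    have hA : ∀ Q : Cube d, (∏ j, (∫⁻ y in Q.set, σ j y) ^ c j) * (∫⁻ y in Q.set, u y) ^ B
        ≤ a * Q.vol ^ (∑ j, i j) := by
      intro Q
      have h1 : (∏ j, ((∫⁻ y in Q.set, σ j y) / Q.vol) ^ c j) *
          ((∫⁻ y in Q.set, u y) / Q.vol) ^ B ≤ a := by
        refine le_trans (le_of_eq ?_) (le_iSup _ Q)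
        congr 1
        · refine Finset.prod_congr rfl fun j _ => ?_
          have hne : ((r j)⁻¹ - (p j)⁻¹)⁻¹ ≠ ∞ := by
            rw [Ne, ENNReal.inv_eq_top]; exact hdiff0 j
          rw [avg, if_neg hne, ENNReal.toReal_inv]
          simp only [hσ, hc, one_div, inv_inv]
        · rw [ENNReal.inv_top, tsub_zero, avg, if_neg hpne, ← hPdef, hPB]
          simp only [hu, hPB, one_div, inv_inv]
      have hsplit : ∑ j, i j = ∑ j, c j + B := by
        rw [← hbB, ← Finset.sum_add_distrib]; exact Finset.sum_congr rfl fun j _ => hicb j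
      refine le_trans (le_of_eq ?_) (mul_le_mul' h1 le_rfl)
      rw [hsplit, ENNReal.rpow_add _ _ Q.vol_ne_zero_s3 Q.vol_ne_top_s3, mul_mul_mul_comm,
        ← rpow_sum_aux _ _ Q.vol_ne_zero_s3 Q.vol_ne_top_s3, ← Finset.prod_mul_distrib,
        ← ENNReal.mul_rpow_of_nonneg _ _ hB0.le,
        ENNReal.div_mul_cancel Q.vol_ne_zero_s3 Q.vol_ne_top_s3]
      congr 1
      refine Finset.prod_congr rfl fun j _ => ?_
      rw [← ENNReal.mul_rpow_of_nonneg _ _ (hc0 j).le,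
        ENNReal.div_mul_cancel Q.vol_ne_zero_s3 Q.vol_ne_top_s3]
    have hmain := hcore c i b (fun j => γ * c j - i j) B P hB0 hPB hi0 hc0 hb0 hbB hicb
      (fun j => sub_nonneg.2 ((div_le_iff₀ (hc0 j)).1 (hγj j))) (fun j => rfl) σ u
      (fun j => ((hw j).inv.ennreal_ofReal).pow_const _)
      (fun j x => by simp only [hσ]; simp [ENNReal.rpow_eq_zero_iff, hw0 j x])
      (fun j x => ENNReal.rpow_ne_top_of_nonneg (by have := hc0 j; positivity) (by simp))
      (fun x => by
        simp only [hu, hσ]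
        rw [ENNReal.ofReal_prod_of_nonneg fun j _ => (hw0 j x).le,
          ← ENNReal.prod_rpow_of_nonneg hP0.le]
        refine Finset.prod_congr rfl fun j _ => ?_
        rw [ENNReal.ofReal_inv_of_pos (hw0 j x), ← ENNReal.rpow_mul, ENNReal.inv_rpow,
          ← ENNReal.rpow_neg]
        congr 1
        have := (hc0 j).ne'
        field_simp)
      a ha hA (fun j x => nn (f j) x ^ (r j).toReal)
      (fun j => ((hf j).nnnorm.coe_nnreal_ennreal).pow_const _) k F hF hkF
      (maximal r (fun j => nn (f j)))
      (fun x => by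
        unfold maximal
        refine iSup₂_mono fun Q _ => le_of_eq ?_
        refine Finset.prod_congr rfl fun j _ => ?_
        rw [avg, if_neg (hr j).2])
    rw [wNorm, eNorm, if_neg hpne, ← hPdef]
    have e1 : ∫⁻ x, (maximal r (fun j => nn (f j)) x * ENNReal.ofReal (∏ j, w j x)) ^ P
        = ∫⁻ x, maximal r (fun j => nn (f j)) x ^ P * u x :=
      lintegral_congr fun x => ENNReal.mul_rpow_of_nonneg _ _ hP0.le
    rw [e1]
    have hcan : ∀ z : ℝ≥0∞, (z ^ P) ^ (1 / P) = z := fun z => by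
      rw [← ENNReal.rpow_mul, mul_one_div_cancel hP0.ne', ENNReal.rpow_one]
    have hP1 : 0 ≤ 1 / P := by positivity
    calc _ ≤ ((((5 : ℝ≥0∞) ^ d) ^ (γ * ∑ j, i j) * a ^ γ) ^ P * (C2 *
            (∏ j, k j * (∫⁻ x, F j x) ^ b j) ^ P)) ^ (1 / P) :=
          ENNReal.rpow_le_rpow hmain hP1
      _ = (((5 : ℝ≥0∞) ^ d) ^ (γ * ∑ j, i j) * a ^ γ) * (C2 ^ (1 / P) *
            ∏ j, k j * (∫⁻ x, F j x) ^ b j) := by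
          rw [ENNReal.mul_rpow_of_nonneg _ _ hP1, ENNReal.mul_rpow_of_nonneg _ _ hP1, hcan, hcan]
      _ ≤ (((5 : ℝ≥0∞) ^ d) ^ (γ * ∑ j, i j) * a ^ γ) * (C2 ^ (1 / P) *
            ∏ j, K j * wNorm (p j) (w j) (nn (f j))) := by
          refine mul_le_mul' le_rfl (mul_le_mul' le_rfl (Finset.prod_le_prod' fun j _ => hkn j))
      _ = _ := by rw [Finset.prod_mul_distrib]; ring

end
end
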